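/- arXiv:1207.2313 — 6 statements merged into one kernel-verified Lean document; each statement's English description precedes it below -/
import Mathlib

section
/- Let O(Σ_q³) be the coordinate *-algebra of the quantum Seifert manifold. Then the set {ζ₀^r ζ₁^s ξ^t : r,s ∈ ℕ, t ∈ ℤ} ∪ {ζ₀*^r ζ₁^s ξ^t : r ∈ ℕ, r ≥ 1, s ∈ ℕ, t ∈ ℤ} is a basis of O(Σ_q³) as a complex vector space. -/
/-- The defining relations of the coordinate *-algebra `O(Σ_q³)` of the quantum Seifert
manifold: `ζ₀ζ₁ = qζ₁ζ₀`, `ζ₀ζ₁* = qζ₁*ζ₀`, `ζ₀ζ₀* = ζ₀*ζ₀ + (q⁻²−1)ζ₁²ξ`,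
`ζ₀ζ₀* + ζ₁²ξ = 1`, `ζ₁* = ζ₁ξ`, with `ξ` central (it suffices to commute with the
generators and their adjoints) and unitary. -/
structure SigmaRels {A : Type} [Ring A] [Algebra ℂ A] [StarRing A] [StarModule ℂ A]
    (q : ℝ) (z0 z1 ξ : A) : Prop where
  central_z0 : ξ * z0 = z0 * ξ
  central_z1 : ξ * z1 = z1 * ξ
  central_z0s : ξ * star z0 = star z0 * ξ
  central_z1s : ξ * star z1 = star z1 * ξ
  unitary : ξ * star ξ = 1
  unitary' : star ξ * ξ = 1
  rel1 : z0 * z1 = (q : ℂ) • (z1 * z0)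
  rel2 : z0 * star z1 = (q : ℂ) • (star z1 * z0)
  rel3 : z0 * star z0 = star z0 * z0 + (((q : ℂ)⁻¹) ^ 2 - 1) • (z1 ^ 2 * ξ)
  rel4 : z0 * star z0 + z1 ^ 2 * ξ = 1
  rel5 : star z1 = z1 * ξ

/-- A presentation of `O(Σ_q³)`: the *universal* unital complex *-algebra with
generators `ζ₀, ζ₁` and a central unitary `ξ` subject to `SigmaRels`. -/
structure SigmaAlg (q : ℝ) where
  A : Type
  [ringA : Ring A]
  [algA : Algebra ℂ A]
  [starA : StarRing A]
  [smodA : StarModule ℂ A]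
  z0 : A
  z1 : A
  ξ : A
  rels : SigmaRels q z0 z1 ξ
  universal : ∀ (B : Type) [Ring B] [Algebra ℂ B] [StarRing B] [StarModule ℂ B]
      (w0 w1 η : B), SigmaRels q w0 w1 η →
      ∃! f : A →⋆ₐ[ℂ] B, f z0 = w0 ∧ f z1 = w1 ∧ f ξ = η

attribute [instance] SigmaAlg.ringA SigmaAlg.algA SigmaAlg.starA SigmaAlg.smodA

/-- Integer powers of a unitary element: `ξ^t` for `t ≥ 0` and `(ξ*)^{−t}` for `t < 0`. -/
def zpowStar {A : Type*} [Monoid A] [Star A] (ξ : A) : ℤ → A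
  | Int.ofNat n => ξ ^ n
  | Int.negSucc n => (star ξ) ^ (n + 1)

/-- The family `{ζ₀^r ζ₁^s ξ^t : r,s ∈ ℕ, t ∈ ℤ} ∪ {ζ₀*^r ζ₁^s ξ^t : r ≥ 1, s ∈ ℕ, t ∈ ℤ}`
in `O(Σ_q³)` (in the second component of the index the first coordinate `r` encodes the
exponent `r + 1 ≥ 1` of `ζ₀*`). -/
def sigmaBasisFamily {q : ℝ} (P : SigmaAlg q) : (ℕ × ℕ × ℤ) ⊕ (ℕ × ℕ × ℤ) → P.A
  | Sum.inl (r, s, t) => P.z0 ^ r * P.z1 ^ s * zpowStar P.ξ t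
  | Sum.inr (r, s, t) => (star P.z0) ^ (r + 1) * P.z1 ^ s * zpowStar P.ξ t

/-! ### Spanning -/

theorem zpowStar_eq_units_zpow {A : Type} [Ring A] [StarRing A] (u : Aˣ) (hu : star (u : A) = ↑u⁻¹) (t : ℤ) :
    zpowStar (u : A) t = ↑(u ^ t) := by
  cases t with
  | ofNat n => simp [zpowStar]
  | negSucc n => simp [zpowStar, hu, zpow_negSucc, ← inv_pow]

theorem mul_pow_eq_smul {A : Type} [Ring A] [Algebra ℂ A] {a b : A} {c : ℂ}
    (h : a * b = c • (b * a)) (r : ℕ) :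
    a * b ^ r = c ^ r • (b ^ r * a) := by
  induction r with
  | zero => simp
  | succ r ih =>
    rw [pow_succ, ← mul_assoc, ih, smul_mul_assoc, mul_assoc, h, mul_smul_comm, smul_smul,
      ← pow_succ, ← mul_assoc]

section Spanning

variable {A : Type} [Ring A] [Algebra ℂ A] [StarRing A] [StarModule ℂ A] {q : ℝ} {z0 z1 ξ : A}

/-- The central unitary `ξ` as a unit. -/
def SigmaRels.unit (h : SigmaRels q z0 z1 ξ) : Aˣ := ⟨ξ, star ξ, h.unitary, h.unitary'⟩

theorem SigmaRels.zpowStar_eq (h : SigmaRels q z0 z1 ξ) (t : ℤ) :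
    zpowStar ξ t = ↑(h.unit ^ t) :=
  zpowStar_eq_units_zpow h.unit rfl t

theorem SigmaRels.mul_zpowStar (h : SigmaRels q z0 z1 ξ) (t : ℤ) :
    ξ * zpowStar ξ t = zpowStar ξ (t + 1) := by
  rw [h.zpowStar_eq, h.zpowStar_eq, add_comm, zpow_add, zpow_one, Units.val_mul]
  rfl

theorem SigmaRels.star_mul_zpowStar (h : SigmaRels q z0 z1 ξ) (t : ℤ) :
    star ξ * zpowStar ξ t = zpowStar ξ (t - 1) := by
  rw [h.zpowStar_eq, h.zpowStar_eq, sub_eq_neg_add, zpow_add, zpow_neg_one, Units.val_mul]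
  rfl

theorem SigmaRels.star_commute_z0 (h : SigmaRels q z0 z1 ξ) : Commute (star ξ) z0 := by
  simpa using (show Commute ξ (star z0) from h.central_z0s).star_star

theorem SigmaRels.star_commute_star_z0 (h : SigmaRels q z0 z1 ξ) :
    Commute (star ξ) (star z0) :=
  (show Commute ξ z0 from h.central_z0).star_star

theorem SigmaRels.star_commute_z1 (h : SigmaRels q z0 z1 ξ) : Commute (star ξ) z1 := by
  simpa using (show Commute ξ (star z1) from h.central_z1s).star_star

theorem SigmaRels.z1_mul_z0 (h : SigmaRels q z0 z1 ξ) (hq : (q : ℂ) ≠ 0) :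
    z1 * z0 = (q : ℂ)⁻¹ • (z0 * z1) := by
  rw [h.rel1, smul_smul, inv_mul_cancel₀ hq, one_smul]

theorem SigmaRels.z1_mul_star_z0 (h : SigmaRels q z0 z1 ξ) :
    z1 * star z0 = (q : ℂ) • (star z0 * z1) := by
  have := congrArg star h.rel2
  simpa using this

theorem SigmaRels.star_z0_mul_z0 (h : SigmaRels q z0 z1 ξ) :
    star z0 * z0 = 1 - ((q : ℂ)⁻¹) ^ 2 • (z1 ^ 2 * ξ) := by
  have h3 := h.rel3
  rw [← h.rel4, h3, sub_smul, one_smul]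
  abel

end Spanning

section Span

variable {q : ℝ} (P : SigmaAlg q)

/-- The span of the monomials. -/
abbrev monomialSpan : Submodule ℂ P.A := Submodule.span ℂ (Set.range (sigmaBasisFamily P))

theorem z0_monomial_mem (r s : ℕ) (t : ℤ) :
    P.z0 ^ r * P.z1 ^ s * zpowStar P.ξ t ∈ monomialSpan P :=
  Submodule.subset_span ⟨Sum.inl (r, s, t), rfl⟩

theorem star_z0_monomial_mem (r s : ℕ) (t : ℤ) :
    star P.z0 ^ r * P.z1 ^ s * zpowStar P.ξ t ∈ monomialSpan P := by
  cases r with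
  | zero => simpa using z0_monomial_mem P 0 s t
  | succ r => exact Submodule.subset_span ⟨Sum.inr (r, s, t), rfl⟩

/-- To be stable under left multiplication by `a`, the span only needs `a` to map monomials
into it. -/
theorem mul_mem_monomialSpan {a : P.A}
    (h0 : ∀ r s t, a * (P.z0 ^ r * P.z1 ^ s * zpowStar P.ξ t) ∈ monomialSpan P)
    (h1 : ∀ r s t, a * (star P.z0 ^ (r + 1) * P.z1 ^ s * zpowStar P.ξ t) ∈ monomialSpan P) :
    ∀ x ∈ monomialSpan P, a * x ∈ monomialSpan P := by
  intro x hx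
  have : monomialSpan P ≤ (monomialSpan P).comap (LinearMap.mulLeft ℂ a) := by
    rw [Submodule.span_le]
    rintro _ ⟨⟨r, s, t⟩ | ⟨r, s, t⟩, rfl⟩
    · exact h0 r s t
    · exact h1 r s t
  exact this hx

theorem ξ_mul_mem : ∀ x ∈ monomialSpan P, P.ξ * x ∈ monomialSpan P := by
  have key (b : P.A) (hb : Commute P.ξ b) (r s : ℕ) (t : ℤ) :
      P.ξ * (b ^ r * P.z1 ^ s * zpowStar P.ξ t) = b ^ r * P.z1 ^ s * zpowStar P.ξ (t + 1) := by
    rw [← P.rels.mul_zpowStar, ← mul_assoc P.ξ,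
      ((hb.pow_right r).mul_right (Commute.pow_right P.rels.central_z1 s)).eq,
      mul_assoc _ P.ξ]
  refine mul_mem_monomialSpan P (fun r s t => ?_) (fun r s t => ?_)
  · rw [key _ P.rels.central_z0]; exact z0_monomial_mem P _ _ _
  · rw [key _ P.rels.central_z0s]; exact star_z0_monomial_mem P _ _ _

theorem star_ξ_mul_mem : ∀ x ∈ monomialSpan P, star P.ξ * x ∈ monomialSpan P := by
  have key (b : P.A) (hb : Commute (star P.ξ) b) (r s : ℕ) (t : ℤ) :
      star P.ξ * (b ^ r * P.z1 ^ s * zpowStar P.ξ t)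
        = b ^ r * P.z1 ^ s * zpowStar P.ξ (t - 1) := by
    rw [← P.rels.star_mul_zpowStar, ← mul_assoc (star P.ξ),
      ((hb.pow_right r).mul_right (P.rels.star_commute_z1.pow_right s)).eq,
      mul_assoc _ (star P.ξ)]
  refine mul_mem_monomialSpan P (fun r s t => ?_) (fun r s t => ?_)
  · rw [key _ P.rels.star_commute_z0]; exact z0_monomial_mem P _ _ _
  · rw [key _ P.rels.star_commute_star_z0]; exact star_z0_monomial_mem P _ _ _

theorem z1_mul_mem (hq : (q : ℂ) ≠ 0) : ∀ x ∈ monomialSpan P, P.z1 * x ∈ monomialSpan P := by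
  have key (b : P.A) (c : ℂ) (hb : P.z1 * b = c • (b * P.z1)) (r s : ℕ) (t : ℤ) :
      P.z1 * (b ^ r * P.z1 ^ s * zpowStar P.ξ t)
        = c ^ r • (b ^ r * P.z1 ^ (s + 1) * zpowStar P.ξ t) := by
    rw [← mul_assoc, ← mul_assoc, mul_pow_eq_smul hb, pow_succ']
    simp only [smul_mul_assoc, mul_assoc]
  refine mul_mem_monomialSpan P (fun r s t => ?_) (fun r s t => ?_)
  · rw [key _ _ (P.rels.z1_mul_z0 hq)]
    exact Submodule.smul_mem _ _ (z0_monomial_mem P _ _ _)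
  · rw [key _ _ P.rels.z1_mul_star_z0]
    exact Submodule.smul_mem _ _ (star_z0_monomial_mem P _ _ _)

theorem z1_sq_mul_ξ_mul_mem (hq : (q : ℂ) ≠ 0) :
    ∀ x ∈ monomialSpan P, P.z1 ^ 2 * P.ξ * x ∈ monomialSpan P := by
  intro x hx
  rw [pow_two, mul_assoc, mul_assoc]
  exact z1_mul_mem P hq _ (z1_mul_mem P hq _ (ξ_mul_mem P x hx))

theorem z0_mul_mem (hq : (q : ℂ) ≠ 0) : ∀ x ∈ monomialSpan P, P.z0 * x ∈ monomialSpan P := by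
  refine mul_mem_monomialSpan P (fun r s t => ?_) (fun r s t => ?_)
  · simpa only [pow_succ', mul_assoc] using z0_monomial_mem P (r + 1) s t
  · have : P.z0 * (star P.z0 ^ (r + 1) * P.z1 ^ s * zpowStar P.ξ t)
        = (P.z0 * star P.z0) * (star P.z0 ^ r * P.z1 ^ s * zpowStar P.ξ t) := by
      simp only [pow_succ', mul_assoc]
    rw [this, eq_sub_of_add_eq P.rels.rel4, sub_mul, one_mul]
    exact Submodule.sub_mem _ (star_z0_monomial_mem P _ _ _)
      (z1_sq_mul_ξ_mul_mem P hq _ (star_z0_monomial_mem P _ _ _))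

theorem star_z0_mul_mem (hq : (q : ℂ) ≠ 0) :
    ∀ x ∈ monomialSpan P, star P.z0 * x ∈ monomialSpan P := by
  refine mul_mem_monomialSpan P (fun r s t => ?_) (fun r s t => ?_)
  · cases r with
    | zero => simpa [mul_assoc] using star_z0_monomial_mem P 1 s t
    | succ r =>
      have : star P.z0 * (P.z0 ^ (r + 1) * P.z1 ^ s * zpowStar P.ξ t)
          = (star P.z0 * P.z0) * (P.z0 ^ r * P.z1 ^ s * zpowStar P.ξ t) := by
        simp only [pow_succ', mul_assoc]
      rw [this, P.rels.star_z0_mul_z0, sub_mul, one_mul, smul_mul_assoc]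
      exact Submodule.sub_mem _ (z0_monomial_mem P _ _ _)
        (Submodule.smul_mem _ _ (z1_sq_mul_ξ_mul_mem P hq _ (z0_monomial_mem P _ _ _)))
  · simpa only [pow_succ', mul_assoc] using star_z0_monomial_mem P (r + 1 + 1) s t

/-- The *-subalgebra of the elements which, together with their adjoints, preserve the span of
the monomials under left multiplication. -/
def monomialStabilizer : StarSubalgebra ℂ P.A where
  carrier := {a | ∀ x ∈ monomialSpan P, a * x ∈ monomialSpan P ∧ star a * x ∈ monomialSpan P}
  mul_mem' {a b} ha hb x hx := by
    rw [star_mul, mul_assoc, mul_assoc]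
    exact ⟨(ha _ (hb x hx).1).1, (hb _ (ha x hx).2).2⟩
  add_mem' {a b} ha hb x hx := by
    rw [star_add, add_mul, add_mul]
    exact ⟨Submodule.add_mem _ (ha x hx).1 (hb x hx).1,
      Submodule.add_mem _ (ha x hx).2 (hb x hx).2⟩
  algebraMap_mem' c x hx := by
    rw [Algebra.algebraMap_eq_smul_one, star_smul, star_one, smul_one_mul, smul_one_mul]
    exact ⟨Submodule.smul_mem _ _ hx, Submodule.smul_mem _ _ hx⟩
  star_mem' {a} ha x hx := by
    rw [star_star]
    exact (ha x hx).symm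

/-- A *-subalgebra containing the generators is everything. -/
theorem SigmaAlg.eq_top_of_generators_mem (T : StarSubalgebra ℂ P.A) (h0 : P.z0 ∈ T)
    (h1 : P.z1 ∈ T) (hξ : P.ξ ∈ T) : T = ⊤ := by
  have rels : SigmaRels q (⟨P.z0, h0⟩ : T) ⟨P.z1, h1⟩ ⟨P.ξ, hξ⟩ :=
    { central_z0 := Subtype.ext P.rels.central_z0
      central_z1 := Subtype.ext P.rels.central_z1
      central_z0s := Subtype.ext P.rels.central_z0s
      central_z1s := Subtype.ext P.rels.central_z1s
      unitary := Subtype.ext P.rels.unitary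
      unitary' := Subtype.ext P.rels.unitary'
      rel1 := Subtype.ext P.rels.rel1
      rel2 := Subtype.ext P.rels.rel2
      rel3 := Subtype.ext P.rels.rel3
      rel4 := Subtype.ext P.rels.rel4
      rel5 := Subtype.ext P.rels.rel5 }
  obtain ⟨f, ⟨hf0, hf1, hfξ⟩, -⟩ := P.universal T _ _ _ rels
  have hid : T.subtype.comp f = StarAlgHom.id ℂ P.A :=
    (P.universal P.A _ _ _ P.rels).unique
      ⟨by simp [hf0], by simp [hf1], by simp [hfξ]⟩ ⟨rfl, rfl, rfl⟩
  refine eq_top_iff.2 fun a _ => ?_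
  have : ((f a : T) : P.A) = a := DFunLike.congr_fun hid a
  exact this ▸ (f a).2

theorem monomialSpan_eq_top (hq : (q : ℂ) ≠ 0) : monomialSpan P = ⊤ := by
  have htop : monomialStabilizer P = ⊤ := by
    refine SigmaAlg.eq_top_of_generators_mem P _ (fun x hx => ?_) (fun x hx => ?_)
      (fun x hx => ?_)
    · exact ⟨z0_mul_mem P hq x hx, star_z0_mul_mem P hq x hx⟩
    · refine ⟨z1_mul_mem P hq x hx, ?_⟩
      rw [P.rels.rel5, mul_assoc]
      exact z1_mul_mem P hq _ (ξ_mul_mem P x hx)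
    · exact ⟨ξ_mul_mem P x hx, star_ξ_mul_mem P x hx⟩
  have hone : (1 : P.A) ∈ monomialSpan P := by
    simpa [zpowStar] using z0_monomial_mem P 0 0 (Int.ofNat 0)
  refine eq_top_iff.2 fun a _ => ?_
  have ha : a ∈ monomialStabilizer P := htop ▸ StarSubalgebra.mem_top
  simpa using (ha 1 hone).1

end Span

/-! ### A model of the relations -/

/-- The product of an algebra with its opposite, with complex conjugate scalars on the second
factor; swapping the factors makes it a *-algebra. -/
def StarDouble (C : Type) : Type := C × Cᵐᵒᵖ

namespace StarDouble

variable {C : Type}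

/-- The element of `StarDouble C` with first component `a`, whose adjoint has first
component `b`. -/
def mk (a b : C) : StarDouble C := (a, MulOpposite.op b)

/-- The first component. -/
def left (x : StarDouble C) : C := x.1

/-- The first component of the adjoint. -/
def right (x : StarDouble C) : C := x.2.unop

@[ext] theorem ext {x y : StarDouble C} (h₁ : x.left = y.left) (h₂ : x.right = y.right) :
    x = y :=
  Prod.ext h₁ (MulOpposite.unop_injective h₂)

@[simp] theorem left_mk (a b : C) : (mk a b).left = a := rfl
@[simp] theorem right_mk (a b : C) : (mk a b).right = b := rfl

variable [Ring C]

instance : Ring (StarDouble C) := inferInstanceAs (Ring (C × Cᵐᵒᵖ))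

instance : StarRing (StarDouble C) where
  star x := mk x.right x.left
  star_involutive _ := rfl
  star_mul _ _ := rfl
  star_add _ _ := rfl

@[simp] theorem left_one : (1 : StarDouble C).left = 1 := rfl
@[simp] theorem right_one : (1 : StarDouble C).right = 1 := rfl
@[simp] theorem left_add (x y : StarDouble C) : (x + y).left = x.left + y.left := rfl
@[simp] theorem right_add (x y : StarDouble C) : (x + y).right = x.right + y.right := rfl
@[simp] theorem left_mul (x y : StarDouble C) : (x * y).left = x.left * y.left := rfl
@[simp] theorem right_mul (x y : StarDouble C) : (x * y).right = y.right * x.right := rfl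
@[simp] theorem left_star (x : StarDouble C) : (star x).left = x.right := rfl
@[simp] theorem right_star (x : StarDouble C) : (star x).right = x.left := rfl

@[simp] theorem left_pow (x : StarDouble C) (n : ℕ) : (x ^ n).left = x.left ^ n := by
  induction n with
  | zero => simp
  | succ n ih => simp [pow_succ, ih]

@[simp] theorem right_pow (x : StarDouble C) (n : ℕ) : (x ^ n).right = x.right ^ n := by
  induction n with
  | zero => simp
  | succ n ih => rw [pow_succ, right_mul, ih, pow_succ']

variable [Algebra ℂ C]

instance : Algebra ℂ (StarDouble C) :=
  RingHom.toAlgebra'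
    ((algebraMap ℂ C).prod ((algebraMap ℂ Cᵐᵒᵖ).comp (starRingEnd ℂ)))
    fun c x => Prod.ext (Algebra.commutes c x.1) (Algebra.commutes (starRingEnd ℂ c) x.2)

@[simp] theorem left_smul (c : ℂ) (x : StarDouble C) : (c • x).left = c • x.left :=
  (Algebra.smul_def c x.left).symm

@[simp] theorem right_smul (c : ℂ) (x : StarDouble C) :
    (c • x).right = starRingEnd ℂ c • x.right :=
  (Algebra.commutes (starRingEnd ℂ c) x.right).symm.trans
    (Algebra.smul_def (starRingEnd ℂ c) x.right).symm

instance : StarModule ℂ (StarDouble C) where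
  star_smul c x := by ext <;> simp

/-- The first component as a linear map. -/
def leftₗ : StarDouble C →ₗ[ℂ] C where
  toFun := left
  map_add' := left_add
  map_smul' := left_smul

end StarDouble

/-- The group of positive real numbers. -/
abbrev PosReal : Type := {x : ℝ // 0 < x}

/-- The space of functions on which the model acts. -/
abbrev ModelSpace : Type := PosReal × PosReal → ℂ

/-- The scaling `(a, τ) ↦ (Qᵈ a, τ)`. -/
noncomputable def scale (Q : PosReal) (d : ℤ) (p : PosReal × PosReal) : PosReal × PosReal :=
  (Q ^ d * p.1, p.2)

theorem scale_scale (Q : PosReal) (d e : ℤ) (p : PosReal × PosReal) :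
    scale Q e (scale Q d p) = scale Q (d + e) p := by
  simp [scale, zpow_add, mul_assoc, mul_left_comm]

theorem scale_zero (Q : PosReal) (p : PosReal × PosReal) : scale Q 0 p = p := by
  simp [scale]

/-- The weighted composition operator `f ↦ h · (f ∘ scale Q d)`. -/
noncomputable def weighted (Q : PosReal) (h : ModelSpace) (d : ℤ) :
    Module.End ℂ ModelSpace where
  toFun f p := h p * f (scale Q d p)
  map_add' f g := by ext p; simp [mul_add]
  map_smul' c f := by ext p; simp [mul_left_comm]

section Weighted

variable (Q : PosReal)

theorem weighted_apply (h : ModelSpace) (d : ℤ) (f : ModelSpace) (p : PosReal × PosReal) :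
    weighted Q h d f p = h p * f (scale Q d p) := rfl

theorem weighted_mul (h k : ModelSpace) (d e : ℤ) :
    weighted Q h d * weighted Q k e
      = weighted Q (fun p => h p * k (scale Q d p)) (d + e) := by
  ext f p
  simp only [Module.End.mul_apply, weighted_apply, scale_scale, mul_assoc]

theorem weighted_one : weighted Q 1 0 = 1 := by
  ext f p
  simp [weighted_apply, scale_zero]

theorem weighted_add (h k : ModelSpace) (d : ℤ) :
    weighted Q h d + weighted Q k d = weighted Q (h + k) d := by
  ext f p
  simp [weighted_apply, add_mul]

theorem weighted_smul (c : ℂ) (h : ModelSpace) (d : ℤ) :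
    c • weighted Q h d = weighted Q (c • h) d := by
  ext f p
  simp [weighted_apply, mul_assoc]

theorem weighted_zero_pow (h : ModelSpace) (n : ℕ) :
    weighted Q h 0 ^ n = weighted Q (h ^ n) 0 := by
  induction n with
  | zero => simp [weighted_one]
  | succ n ih =>
    rw [pow_succ, ih, weighted_mul]
    simp only [scale_zero, add_zero, pow_succ]
    rfl

theorem weighted_one_pow (n : ℕ) : weighted Q 1 1 ^ n = weighted Q 1 n := by
  induction n with
  | zero => simp [weighted_one]
  | succ n ih =>
    rw [pow_succ, ih, weighted_mul]
    congr 1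
    ext p; simp

/-- Powers of a nowhere vanishing weighted composition operator are again such. -/
theorem exists_weighted_pow (h : ModelSpace) (hh : ∀ p, h p ≠ 0) (d : ℤ) (n : ℕ) :
    ∃ G : ModelSpace, (∀ p, G p ≠ 0) ∧ weighted Q h d ^ n = weighted Q G (n * d) := by
  induction n with
  | zero => exact ⟨1, by simp, by simp [weighted_one]⟩
  | succ n ih =>
    obtain ⟨G, hG, e⟩ := ih
    refine ⟨_, fun p => mul_ne_zero (hG p) (hh (scale Q (n * d) p)), ?_⟩
    rw [pow_succ, e, weighted_mul]
    congr 1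
    push_cast; ring

/-- The first coordinate. -/
noncomputable def coordA : ModelSpace := fun p => ((p.1 : ℝ) : ℂ)

/-- The negative of the second coordinate: this sign keeps `adjWeight` from vanishing. -/
noncomputable def coordT : ModelSpace := fun p => -((p.2 : ℝ) : ℂ)

/-- The weight of the operator representing `ζ₀*`. -/
noncomputable def adjWeight : ModelSpace :=
  fun p => 1 - ((Q : ℝ) : ℂ)⁻¹ ^ 2 * (coordA p ^ 2 * coordT p)

theorem adjWeight_ne_zero (p : PosReal × PosReal) : adjWeight Q p ≠ 0 := by
  have h1 := p.1.2
  have h2 := p.2.2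
  have h3 := Q.2
  have : adjWeight Q p = ((1 + ((Q : ℝ))⁻¹ ^ 2 * ((p.1 : ℝ) ^ 2 * (p.2 : ℝ)) : ℝ) : ℂ) := by
    simp [adjWeight, coordA, coordT]
  rw [this, Complex.ofReal_ne_zero]
  positivity

theorem coordT_ne_zero (p : PosReal × PosReal) : coordT p ≠ 0 := by
  simpa [coordT] using p.2.2.ne'

theorem coordA_scale (d : ℤ) (p : PosReal × PosReal) :
    coordA (scale Q d p) = ((Q : ℝ) : ℂ) ^ d * coordA p := by
  simp [coordA, scale]

theorem coordT_scale (d : ℤ) (p : PosReal × PosReal) :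
    coordT (scale Q d p) = coordT p := rfl

/-- The image of `ζ₀`. -/
noncomputable def modelZ0 : StarDouble (Module.End ℂ ModelSpace) :=
  .mk (weighted Q 1 1) (weighted Q (adjWeight Q) (-1))

/-- The image of `ζ₁`. -/
noncomputable def modelZ1 : StarDouble (Module.End ℂ ModelSpace) :=
  .mk (weighted Q coordA 0) (weighted Q (coordA * coordT) 0)

/-- The image of `ξ`. -/
noncomputable def modelξ : StarDouble (Module.End ℂ ModelSpace) :=
  .mk (weighted Q coordT 0) (weighted Q coordT⁻¹ 0)

theorem model_rels : SigmaRels (Q : ℝ) (modelZ0 Q) (modelZ1 Q) (modelξ Q) := by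
  have hQ : ((Q : ℝ) : ℂ) ≠ 0 := by simpa using Q.2.ne'
  constructor <;> apply StarDouble.ext <;>
    simp only [modelZ0, modelZ1, modelξ, StarDouble.left_mk, StarDouble.right_mk,
      StarDouble.left_mul, StarDouble.right_mul, StarDouble.left_star, StarDouble.right_star,
      StarDouble.left_one, StarDouble.right_one, StarDouble.left_add, StarDouble.right_add,
      StarDouble.left_smul, StarDouble.right_smul, StarDouble.left_pow, StarDouble.right_pow,
      weighted_mul, weighted_zero_pow, weighted_smul, ← weighted_one Q, weighted_add,
      add_zero, zero_add, add_neg_cancel, neg_add_cancel] <;>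
    congr 1 <;> ext p <;> have hT := coordT_ne_zero p <;>
    simp [adjWeight, coordA_scale, coordT_scale, scale_zero] <;> field_simp <;> ring

end Weighted

/-! ### Linear independence -/

/-- The character `(a, τ) ↦ aˢ τᵗ`. -/
noncomputable def monomialChar (k : ℕ × ℤ) : PosReal × PosReal →* ℂ where
  toFun p := ((p.1 : ℝ) : ℂ) ^ k.1 * ((p.2 : ℝ) : ℂ) ^ k.2
  map_one' := by simp
  map_mul' p p' := by simp [mul_pow, mul_zpow, mul_mul_mul_comm]

theorem monomialChar_injective : Function.Injective monomialChar := by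
  rintro ⟨s, t⟩ ⟨s', t'⟩ h
  have h1 := DFunLike.congr_fun h (⟨2, two_pos⟩, 1)
  have h2 := DFunLike.congr_fun h (1, ⟨2, two_pos⟩)
  simp only [monomialChar, MonoidHom.coe_mk, OneHom.coe_mk] at h1 h2
  norm_num at h1 h2
  have h1' : (2 : ℝ) ^ s = 2 ^ s' := Complex.ofReal_injective (by push_cast; exact h1)
  have h2' : (2 : ℝ) ^ t = 2 ^ t' := Complex.ofReal_injective (by push_cast; exact h2)
  rw [pow_right_injective₀ two_pos (by norm_num) h1',
    zpow_right_injective₀ two_pos (by norm_num) h2']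

theorem linearIndependent_monomialChar :
    LinearIndependent ℂ fun k => (monomialChar k : PosReal × PosReal → ℂ) :=
  (linearIndependent_monoidHom (PosReal × PosReal) ℂ).comp _ monomialChar_injective

/-- The power of the scaling occurring in a monomial. -/
def monomialDegree : (ℕ × ℕ × ℤ) ⊕ (ℕ × ℕ × ℤ) → ℤ
  | Sum.inl (r, _, _) => r
  | Sum.inr (r, _, _) => -(r + 1)

/-- The exponents of `ζ₁` and `ξ` in a monomial. -/
def monomialExponents : (ℕ × ℕ × ℤ) ⊕ (ℕ × ℕ × ℤ) → ℕ × ℤ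
  | Sum.inl (_, k) => k
  | Sum.inr (_, k) => k

theorem monomial_ext {i j : (ℕ × ℕ × ℤ) ⊕ (ℕ × ℕ × ℤ)}
    (hd : monomialDegree i = monomialDegree j)
    (he : monomialExponents i = monomialExponents j) : i = j := by
  rcases i with ⟨r, s, t⟩ | ⟨r, s, t⟩ <;> rcases j with ⟨r', s', t'⟩ | ⟨r', s', t'⟩ <;>
    simp only [monomialDegree, monomialExponents, Prod.mk.injEq, Sum.inl.injEq, Sum.inr.injEq,
      reduceCtorEq] at * <;> omega

theorem scale_injective {Q : PosReal} (hQ : (Q : ℝ) < 1) (p : PosReal × PosReal) :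
    Function.Injective fun d => scale Q d p := by
  intro d e h
  have h1 : Q ^ d * p.1 = Q ^ e * p.1 := congrArg Prod.fst h
  have h2 : (Q : ℝ) ^ d = (Q : ℝ) ^ e := by
    simpa using congrArg (fun x : PosReal => (x : ℝ)) (mul_right_cancel h1)
  exact zpow_right_injective₀ Q.2 hQ.ne h2

/-- Weighted composition operators are independent if, within each degree, their weights are
distinct characters up to a common nowhere vanishing function and nonzero constants. -/
theorem linearIndependent_weighted {Q : PosReal} (hQ : (Q : ℝ) < 1) {G : ℤ → ModelSpace}
    (hG : ∀ d p, G d p ≠ 0) {κ : (ℕ × ℕ × ℤ) ⊕ (ℕ × ℕ × ℤ) → ℂ} (hκ : ∀ i, κ i ≠ 0) :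
    LinearIndependent ℂ fun i => weighted Q
      (fun p => G (monomialDegree i) p * (κ i * monomialChar (monomialExponents i) p))
      (monomialDegree i) := by
  classical
  rw [linearIndependent_iff']
  intro S c hc i₀ hi₀
  set d := monomialDegree i₀ with hd
  have hind : LinearIndependent ℂ fun i : {i // monomialDegree i = d} =>
      (monomialChar (monomialExponents i) : PosReal × PosReal → ℂ) :=
    linearIndependent_monomialChar.comp (fun i : {i // monomialDegree i = d} =>
      monomialExponents i) fun i j hij => Subtype.ext (monomial_ext (i.2.trans j.2.symm) hij)
  have hsum : ∑ i ∈ S.subtype (fun i => monomialDegree i = d), (c i * κ i) •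
      (monomialChar (monomialExponents i) : PosReal × PosReal → ℂ) = 0 := by
    ext p
    have h := congrFun (LinearMap.congr_fun hc (Pi.single (scale Q d p) 1)) p
    simp only [LinearMap.sum_apply, Finset.sum_apply, LinearMap.smul_apply, Pi.smul_apply,
      weighted_apply, LinearMap.zero_apply, Pi.zero_apply] at h
    refine (mul_eq_zero.1 (Eq.trans ?_ h)).resolve_left (hG d p)
    rw [Finset.sum_subtype_eq_sum_filter (fun i => (c i * κ i) •
      (monomialChar (monomialExponents i) : PosReal × PosReal → ℂ)), Finset.sum_apply,
      Finset.mul_sum, Finset.sum_filter]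
    refine Finset.sum_congr rfl fun i _ => ?_
    by_cases hi : monomialDegree i = d
    · rw [if_pos hi, hi, Pi.single_eq_same, Pi.smul_apply, smul_eq_mul, smul_eq_mul]
      ring
    · rw [if_neg hi, Pi.single_eq_of_ne ((scale_injective hQ p).ne hi), mul_zero, smul_zero]
  have := linearIndependent_iff'.1 hind _ _ hsum ⟨i₀, rfl⟩ (by simpa using hi₀)
  exact (mul_eq_zero.1 this).resolve_right (hκ i₀)

theorem left_zpowStar_modelξ (Q : PosReal) (t : ℤ) :
    (zpowStar (modelξ Q) t).left = weighted Q (fun p => coordT p ^ t) 0 := by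
  cases t with
  | ofNat n =>
    simp only [zpowStar, StarDouble.left_pow, modelξ, StarDouble.left_mk, weighted_zero_pow]
    simp only [Int.ofNat_eq_natCast, zpow_natCast]
    rfl
  | negSucc n =>
    simp only [zpowStar, StarDouble.left_pow, modelξ, StarDouble.left_star,
      StarDouble.right_mk, weighted_zero_pow]
    congr 1
    ext p; simp [zpow_negSucc]

theorem weighted_monomial {Q : PosReal} (h : ModelSpace) (d : ℤ) (s : ℕ) (t : ℤ) :
    weighted Q h d * (modelZ1 Q ^ s).left * (zpowStar (modelξ Q) t).left
      = weighted Q (fun p => h p *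
        ((((Q : ℝ) : ℂ) ^ d) ^ s * (-1) ^ t * monomialChar (s, t) p)) d := by
  rw [left_zpowStar_modelξ, StarDouble.left_pow, modelZ1, StarDouble.left_mk, weighted_zero_pow,
    weighted_mul, weighted_mul]
  simp only [add_zero]
  congr 1
  ext p
  have : coordT p ^ t = (-1) ^ t * ((p.2 : ℝ) : ℂ) ^ t := by
    rw [coordT, neg_eq_neg_one_mul, mul_zpow]
  simp only [coordT_scale, Pi.pow_apply, coordA_scale, this, mul_pow]
  simp only [monomialChar, MonoidHom.coe_mk, OneHom.coe_mk, coordA]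
  ring

theorem linearIndependent_model {Q : PosReal} (hQ : (Q : ℝ) < 1)
    (v : (ℕ × ℕ × ℤ) ⊕ (ℕ × ℕ × ℤ) → Module.End ℂ ModelSpace)
    (hl : ∀ r s t, v (Sum.inl (r, s, t))
      = (modelZ0 Q ^ r * modelZ1 Q ^ s * zpowStar (modelξ Q) t).left)
    (hr : ∀ r s t, v (Sum.inr (r, s, t))
      = (star (modelZ0 Q) ^ (r + 1) * modelZ1 Q ^ s * zpowStar (modelξ Q) t).left) :
    LinearIndependent ℂ v := by
  choose G hG hGpow using
    exists_weighted_pow Q (adjWeight Q) (adjWeight_ne_zero Q) (-1)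
  have hQ0 : ((Q : ℝ) : ℂ) ≠ 0 := by simpa using Q.2.ne'
  have key := linearIndependent_weighted hQ
    (G := fun d p => if 0 ≤ d then 1 else G d.natAbs p)
    (κ := fun i => (((Q : ℝ) : ℂ) ^ monomialDegree i) ^ (monomialExponents i).1
      * (-1) ^ (monomialExponents i).2)
    (fun d p => by
      split_ifs
      · exact one_ne_zero
      · exact hG _ p)
    (fun i => mul_ne_zero (pow_ne_zero _ (zpow_ne_zero _ hQ0)) (zpow_ne_zero _ (by norm_num)))
  convert key using 1
  ext1 i
  rcases i with ⟨r, s, t⟩ | ⟨r, s, t⟩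
  · rw [hl, StarDouble.left_mul, StarDouble.left_mul, StarDouble.left_pow (modelZ0 Q), modelZ0,
      StarDouble.left_mk, weighted_one_pow, weighted_monomial]
    simp [monomialDegree, monomialExponents]
  · rw [hr, StarDouble.left_mul, StarDouble.left_mul, StarDouble.left_pow (star _), modelZ0,
      StarDouble.left_star, StarDouble.right_mk, hGpow, weighted_monomial]
    have h1 : ¬ (0 : ℤ) ≤ -((r : ℤ) + 1) := by omega
    have h2 : (-((r : ℤ) + 1)).natAbs = r + 1 := by omega
    have h3 : ((r + 1 : ℕ) : ℤ) * -1 = -((r : ℤ) + 1) := by push_cast; ring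
    simp only [monomialDegree, monomialExponents, if_neg h1, h2, h3]

theorem StarAlgHom.map_zpowStar {A B : Type} [Ring A] [Algebra ℂ A] [StarRing A] [Ring B]
    [Algebra ℂ B] [StarRing B] (f : A →⋆ₐ[ℂ] B) (x : A) (t : ℤ) :
    f (zpowStar x t) = zpowStar (f x) t := by
  cases t <;> simp [zpowStar, map_star]

theorem linearIndependent_sigmaBasisFamily {q : ℝ} (hq0 : 0 < q) (hq1 : q < 1)
    (P : SigmaAlg q) : LinearIndependent ℂ (sigmaBasisFamily P) := by
  obtain ⟨f, ⟨h0, h1, hξ⟩, -⟩ := P.universal _ _ _ _ (model_rels ⟨q, hq0⟩)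
  refine LinearIndependent.of_comp (StarDouble.leftₗ ∘ₗ f.toAlgHom.toLinearMap)
    (linearIndependent_model (Q := ⟨q, hq0⟩) hq1 _ (fun r s t => ?_) (fun r s t => ?_))
  · change (f (P.z0 ^ r * P.z1 ^ s * zpowStar P.ξ t)).left = _
    rw [map_mul, map_mul, map_pow, map_pow, StarAlgHom.map_zpowStar, h0, h1, hξ]
  · change (f (star P.z0 ^ (r + 1) * P.z1 ^ s * zpowStar P.ξ t)).left = _
    rw [map_mul, map_mul, map_pow, map_pow, StarAlgHom.map_zpowStar, map_star, h0, h1, hξ]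

/-- the set
`{ζ₀^r ζ₁^s ξ^t : r,s ∈ ℕ, t ∈ ℤ} ∪ {ζ₀*^r ζ₁^s ξ^t : r ≥ 1, s,∈ ℕ, t ∈ ℤ}` is a basis
of the coordinate *-algebra `O(Σ_q³)` as a complex vector space: the family is linearly
independent (in particular its members are pairwise distinct) and spans `O(Σ_q³)`. -/
theorem sigmaBasisFamily_isBasis (q : ℝ) (hq0 : 0 < q) (hq1 : q < 1) (P : SigmaAlg q) :
    LinearIndependent ℂ (sigmaBasisFamily P) ∧
      Submodule.span ℂ (Set.range (sigmaBasisFamily P)) = ⊤ :=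
  ⟨linearIndependent_sigmaBasisFamily hq0 hq1 P,
    monomialSpan_eq_top P (Complex.ofReal_ne_zero.2 hq0.ne')⟩
end

section
/- In O(Σ_q³) the following identities hold for all natural numbers m, n: if m ≥ n then ζ₀^m ζ₀*^n = ζ₀^{m−n} ∏_{p=0}^{n−1}(1 − q^{2p}ζ₁²ξ) and ζ₀*^n ζ₀^m = ∏_{p=1}^{n}(1 − q^{−2p}ζ₁²ξ) ζ₀^{m−n}; if n ≥ m then ζ₀^m ζ₀*^n = ∏_{p=0}^{m−1}(1 − q^{2p}ζ₁²ξ) ζ₀*^{n−m} and ζ₀*^n ζ₀^m = ζ₀*^{n−m} ∏_{p=1}^{m}(1 − q^{−2p}ζ₁²ξ). -/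
/-- If `a b = 1 - d x` and `x b = c b x`, then `aⁿ bⁿ = ∏_{p < n} (1 - d cᵖ x)`. -/
theorem pow_mul_pow_eq_prod_of_smul_comm {R A : Type*} [CommRing R] [Ring A] [Algebra R A]
    {a b x : A} {c d : R} (hab : a * b = 1 - d • x) (hxb : x * b = c • (b * x)) (n : ℕ) :
    a ^ n * b ^ n = ((List.range n).map (fun p => 1 - (d * c ^ p) • x)).prod := by
  have hx : ∀ k : ℕ, x * b ^ k = c ^ k • (b ^ k * x) := by
    intro k
    induction k with
    | zero => simp
    | succ k ih =>
      rw [pow_succ b, ← mul_assoc, ih, smul_mul_assoc, mul_assoc, hxb, mul_smul_comm, smul_smul,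
        ← mul_assoc, pow_succ c]
  induction n with
  | zero => simp
  | succ n ih =>
    rw [List.range_succ, List.map_append, List.prod_append, ← ih, List.map_singleton,
      List.prod_singleton]
    calc a ^ (n + 1) * b ^ (n + 1) = a ^ n * (a * b) * b ^ n := by
          rw [pow_succ a, pow_succ' b]; simp only [mul_assoc]
      _ = a ^ n * b ^ n * (1 - (d * c ^ n) • x) := by
          rw [hab, mul_assoc, mul_assoc, sub_mul, smul_mul_assoc, hx, smul_smul, one_mul,
            mul_sub (b ^ n), mul_one, mul_smul_comm]

namespace SigmaRels

variable {A : Type} [Ring A] [Algebra ℂ A] [StarRing A] [StarModule ℂ A] {q : ℝ} {z0 z1 ξ : A}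

theorem z0_mul_sq_mul (h : SigmaRels q z0 z1 ξ) :
    z0 * (z1 ^ 2 * ξ) = (q : ℂ) ^ 2 • (z1 ^ 2 * ξ * z0) := by
  calc z0 * (z1 ^ 2 * ξ) = z0 * z1 * z1 * ξ := by rw [pow_two]; simp only [mul_assoc]
    _ = (q : ℂ) • (z1 * (z0 * z1) * ξ) := by
        nth_rewrite 1 [h.rel1]
        rw [smul_mul_assoc, smul_mul_assoc, mul_assoc z1]
    _ = (q : ℂ) ^ 2 • (z1 ^ 2 * ξ * z0) := by
        rw [h.rel1, mul_smul_comm, smul_mul_assoc, smul_smul, ← pow_two, mul_assoc (z1 ^ 2),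
          h.central_z0, pow_two z1]
        simp only [mul_assoc]

theorem star_sq_mul (h : SigmaRels q z0 z1 ξ) : star (z1 ^ 2 * ξ) = z1 ^ 2 * ξ := by
  have hc : Commute ξ z1 := h.central_z1
  rw [star_mul, star_pow, h.rel5, hc.symm.mul_pow, pow_two ξ, ← mul_assoc (z1 ^ 2),
    ← (hc.pow_right 2).eq, mul_assoc ξ, ← mul_assoc, h.unitary', one_mul,
    (hc.pow_right 2).eq]

theorem sq_mul_mul_star_z0 (h : SigmaRels q z0 z1 ξ) :
    z1 ^ 2 * ξ * star z0 = (q : ℂ) ^ 2 • (star z0 * (z1 ^ 2 * ξ)) := by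
  have := congrArg star h.z0_mul_sq_mul
  rwa [star_mul, star_smul, star_mul (z1 ^ 2 * ξ), h.star_sq_mul, star_pow, Complex.star_def,
    Complex.conj_ofReal] at this

theorem z0_pow_mul_star_z0_pow (h : SigmaRels q z0 z1 ξ) (n : ℕ) :
    z0 ^ n * star z0 ^ n =
      ((List.range n).map (fun p => 1 - ((q : ℂ) ^ (2 * p)) • (z1 ^ 2 * ξ))).prod := by
  have hab : z0 * star z0 = 1 - (1 : ℂ) • (z1 ^ 2 * ξ) := by
    rw [one_smul]; exact eq_sub_of_add_eq h.rel4
  simpa only [one_mul, ← pow_mul] using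
    pow_mul_pow_eq_prod_of_smul_comm hab h.sq_mul_mul_star_z0 n

theorem star_z0_pow_mul_z0_pow (h : SigmaRels q z0 z1 ξ) (hq : q ≠ 0) (n : ℕ) :
    star z0 ^ n * z0 ^ n =
      ((List.range n).map
        (fun p => 1 - (((q : ℂ)⁻¹) ^ (2 * (p + 1))) • (z1 ^ 2 * ξ))).prod := by
  have hab : star z0 * z0 = 1 - ((q : ℂ)⁻¹) ^ 2 • (z1 ^ 2 * ξ) := by
    rw [← h.rel4, h.rel3, sub_smul, one_smul]; abel
  have hxa : z1 ^ 2 * ξ * z0 = ((q : ℂ)⁻¹) ^ 2 • (z0 * (z1 ^ 2 * ξ)) := by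
    rw [h.z0_mul_sq_mul, smul_smul, ← mul_pow, inv_mul_cancel₀ (Complex.ofReal_ne_zero.2 hq),
      one_pow, one_smul]
  simpa only [← pow_mul, ← pow_add, mul_add, mul_one, add_comm 2] using
    pow_mul_pow_eq_prod_of_smul_comm hab hxa n

end SigmaRels

/-- in `O(Σ_q³)`, for all `m, n ∈ ℕ`:
if `m ≥ n` then `ζ₀^m ζ₀*^n = ζ₀^{m−n} ∏_{p=0}^{n−1}(1 − q^{2p}ζ₁²ξ)` and
`ζ₀*^n ζ₀^m = ∏_{p=1}^{n}(1 − q^{−2p}ζ₁²ξ) ζ₀^{m−n}`; if `n ≥ m` then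
`ζ₀^m ζ₀*^n = ∏_{p=0}^{m−1}(1 − q^{2p}ζ₁²ξ) ζ₀*^{n−m}` and
`ζ₀*^n ζ₀^m = ζ₀*^{n−m} ∏_{p=1}^{m}(1 − q^{−2p}ζ₁²ξ)`. -/
theorem sigma_pow_star_identities (q : ℝ) (hq0 : 0 < q) (hq1 : q < 1)
    (P : SigmaAlg q) (m n : ℕ) :
    (n ≤ m →
      P.z0 ^ m * (star P.z0) ^ n =
        P.z0 ^ (m - n) *
          ((List.range n).map (fun p => 1 - ((q : ℂ) ^ (2 * p)) • (P.z1 ^ 2 * P.ξ))).prod ∧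
      (star P.z0) ^ n * P.z0 ^ m =
        ((List.range n).map
            (fun p => 1 - (((q : ℂ)⁻¹) ^ (2 * (p + 1))) • (P.z1 ^ 2 * P.ξ))).prod *
          P.z0 ^ (m - n)) ∧
    (m ≤ n →
      P.z0 ^ m * (star P.z0) ^ n =
        ((List.range m).map (fun p => 1 - ((q : ℂ) ^ (2 * p)) • (P.z1 ^ 2 * P.ξ))).prod *
          (star P.z0) ^ (n - m) ∧
      (star P.z0) ^ n * P.z0 ^ m =
        (star P.z0) ^ (n - m) *
          ((List.range m).map
            (fun p => 1 - (((q : ℂ)⁻¹) ^ (2 * (p + 1))) • (P.z1 ^ 2 * P.ξ))).prod) := by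
  refine ⟨fun hnm => ⟨?_, ?_⟩, fun hmn => ⟨?_, ?_⟩⟩
  · rw [← P.rels.z0_pow_mul_star_z0_pow, ← mul_assoc, ← pow_add, Nat.sub_add_cancel hnm]
  · rw [← P.rels.star_z0_pow_mul_z0_pow hq0.ne', mul_assoc, ← pow_add, Nat.add_sub_cancel' hnm]
  · rw [← P.rels.z0_pow_mul_star_z0_pow, mul_assoc, ← pow_add, Nat.add_sub_cancel' hmn]
  · rw [← P.rels.star_z0_pow_mul_z0_pow hq0.ne', ← mul_assoc, ← pow_add, Nat.sub_add_cancel hmn]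
end

section
/- Let l be a positive integer. There is a ℤ/lℤ-grading of O(Σ_q³) determined by assigning degree 1 (mod l) to ζ₀ and degree 0 to ζ₁ and ξ. The degree-zero component of this grading equals the *-subalgebra of O(Σ_q³) generated by ζ₀^l, ζ₁ and ξ, and the assignment x ↦ ζ₀^l, y ↦ ζ₁, z ↦ ξ defines a *-algebra isomorphism from O(Σ_q³(l,−)) onto this degree-zero component. -/
/-- The defining relations of `O(Σ_q³(l,−))`: `y* = yz`, `xy = q^l yx`,
`xx* = ∏_{p=0}^{l−1}(1 − q^{2p}y²z)`, `x*x = ∏_{p=1}^{l}(1 − q^{−2p}y²z)`, with `z`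
central (it suffices to commute with the generators and their adjoints) and unitary. -/
structure SMinusRels {A : Type} [Ring A] [Algebra ℂ A] [StarRing A] [StarModule ℂ A]
    (q : ℝ) (l : ℕ) (x y z : A) : Prop where
  central_x : z * x = x * z
  central_y : z * y = y * z
  central_xs : z * star x = star x * z
  central_ys : z * star y = star y * z
  unitary : z * star z = 1
  unitary' : star z * z = 1
  rel_ystar : star y = y * z
  rel_xy : x * y = ((q : ℂ) ^ l) • (y * x)
  rel_xxs : x * star x =
    ((List.range l).map (fun p => 1 - ((q : ℂ) ^ (2 * p)) • (y ^ 2 * z))).prod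
  rel_xsx : star x * x =
    ((List.range l).map (fun p => 1 - (((q : ℂ)⁻¹) ^ (2 * (p + 1))) • (y ^ 2 * z))).prod

/-- A presentation of `O(Σ_q³(l,−))`: the *universal* unital complex *-algebra with
generators `x, y` and a central unitary `z` subject to `SMinusRels`. -/
structure SMinusAlg (q : ℝ) (l : ℕ) where
  A : Type
  [ringA : Ring A]
  [algA : Algebra ℂ A]
  [starA : StarRing A]
  [smodA : StarModule ℂ A]
  x : A
  y : A
  z : A
  rels : SMinusRels q l x y z
  universal : ∀ (B : Type) [Ring B] [Algebra ℂ B] [StarRing B] [StarModule ℂ B]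
      (x' y' z' : B), SMinusRels q l x' y' z' →
      ∃! f : A →⋆ₐ[ℂ] B, f x = x' ∧ f y = y' ∧ f z = z'

attribute [instance] SMinusAlg.ringA SMinusAlg.algA SMinusAlg.starA SMinusAlg.smodA

section Commutation

variable {A : Type*} [Ring A] [Algebra ℂ A]

lemma pow_mul_of_mul_eq_smul {x y : A} {c : ℂ} (h : x * y = c • (y * x)) (n : ℕ) :
    x ^ n * y = c ^ n • (y * x ^ n) := by
  induction n with
  | zero => simp
  | succ n ih =>
    rw [pow_succ, mul_assoc, h, mul_smul_comm, ← mul_assoc, ih, smul_mul_assoc, smul_smul,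
      mul_assoc, ← pow_succ']

lemma mul_pow_of_mul_eq_smul {x y : A} {c : ℂ} (h : x * y = c • (y * x)) (n : ℕ) :
    x * y ^ n = c ^ n • (y ^ n * x) := by
  induction n with
  | zero => simp
  | succ n ih =>
    rw [pow_succ, ← mul_assoc, ih, smul_mul_assoc, mul_assoc, h, mul_smul_comm, smul_smul,
      ← pow_succ, mul_assoc]

/-- The subalgebra of elements whose left multiplication preserves a submodule. -/
def Submodule.leftStabilizer (S : Submodule ℂ A) : Subalgebra ℂ A where
  carrier := {a | ∀ s ∈ S, a * s ∈ S}
  mul_mem' ha hb s hs := by rw [mul_assoc]; exact ha _ (hb _ hs)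
  add_mem' ha hb s hs := by rw [add_mul]; exact S.add_mem (ha _ hs) (hb _ hs)
  algebraMap_mem' c s hs := by rw [← Algebra.smul_def]; exact S.smul_mem c hs

lemma mem_leftStabilizer_span {ι : Type*} {v : ι → A} {a : A}
    (h : ∀ i, a * v i ∈ Submodule.span ℂ (Set.range v)) :
    a ∈ (Submodule.span ℂ (Set.range v)).leftStabilizer := by
  intro s hs
  induction hs using Submodule.span_induction with
  | mem s hs => obtain ⟨i, rfl⟩ := hs; exact h i
  | zero => simp
  | add s t _ _ hs ht => rw [mul_add]; exact Submodule.add_mem _ hs ht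
  | smul c s _ hs => rw [mul_smul_comm]; exact Submodule.smul_mem _ c hs

end Commutation

section Monomial

variable {A B : Type*} [Ring A] [StarRing A] [Ring B] [StarRing B]

/-- The power of `x` for a nonnegative exponent and of `star x` for a negative one. -/
def starPow (x : A) : ℤ → A
  | Int.ofNat n => x ^ n
  | Int.negSucc n => star x ^ (n + 1)

@[simp]
lemma starPow_natCast (x : A) (n : ℕ) : starPow x n = x ^ n := rfl

@[simp]
lemma starPow_zero (x : A) : starPow x 0 = 1 := pow_zero x

@[simp]
lemma starPow_neg_natCast (x : A) (n : ℕ) : starPow x (-n) = star x ^ n := by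
  cases n with
  | zero => simp
  | succ n => rfl

lemma map_starPow [Algebra ℂ A] [Algebra ℂ B] (f : A →⋆ₐ[ℂ] B) (x : A) (n : ℤ) :
    f (starPow x n) = starPow (f x) n := by
  obtain ⟨n, rfl | rfl⟩ := n.eq_nat_or_neg <;> simp [map_star]

lemma starPow_pow (x : A) (l : ℕ) (n : ℤ) : starPow (x ^ l) n = starPow x (l * n) := by
  obtain ⟨n, rfl | rfl⟩ := n.eq_nat_or_neg
  · rw [← Nat.cast_mul, starPow_natCast, starPow_natCast, pow_mul]
  · rw [mul_neg, ← Nat.cast_mul, starPow_neg_natCast, starPow_neg_natCast, star_pow, pow_mul]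

/-- The monomial `yᵐ uᵏ xⁿ`, where negative powers of `x` are powers of `star x`. -/
def monomial (u : Aˣ) (x y : A) (i : ℕ × ℤ × ℤ) : A :=
  y ^ i.1 * (u ^ i.2.1 : Aˣ) * starPow x i.2.2

lemma map_monomial [Algebra ℂ A] [Algebra ℂ B] (f : A →⋆ₐ[ℂ] B) {u : Aˣ} {u' : Bˣ} (h : f u = u')
    (x y : A) (i : ℕ × ℤ × ℤ) : f (monomial u x y i) = monomial u' (f x) (f y) i := by
  have hu : Units.map (f : A →* B) u = u' := Units.ext h
  have hk : f (u ^ i.2.1 : Aˣ) = (u' ^ i.2.1 : Bˣ) := by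
    rw [← hu, ← map_zpow]; rfl
  simp only [monomial, map_mul, map_pow, hk, map_starPow]

end Monomial

namespace SMinusRels

variable {A : Type} [Ring A] [Algebra ℂ A] [StarRing A] [StarModule ℂ A]
  {q : ℝ} {l : ℕ} {x y z : A}

/-- The central unitary as a unit. -/
def unit (h : SMinusRels q l x y z) : Aˣ := ⟨z, star z, h.unitary, h.unitary'⟩

lemma star_x_mul_y (h : SMinusRels q l x y z) (hq : q ≠ 0) :
    star x * y = ((q : ℂ) ^ l)⁻¹ • (y * star x) := by
  have hc : (q : ℂ) ^ l ≠ 0 := pow_ne_zero _ (by exact_mod_cast hq)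
  have h1 : x * star y = ((q : ℂ) ^ l) • (star y * x) := by
    rw [h.rel_ystar, ← mul_assoc, h.rel_xy, smul_mul_assoc, mul_assoc, ← h.central_x, mul_assoc]
  have h2 := congrArg star h1
  rw [star_mul, star_star, star_smul, star_mul, star_star, star_pow,
    show star (q : ℂ) = q from Complex.conj_ofReal q] at h2
  rw [h2, smul_smul, inv_mul_cancel₀ hc, one_smul]

lemma commute_z (h : SMinusRels q l x y z) (n : ℤ) : Commute z (starPow x n) := by
  obtain ⟨n, rfl | rfl⟩ := n.eq_nat_or_neg
  · simpa using Commute.pow_right h.central_x n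
  · simpa using Commute.pow_right h.central_xs n

lemma mul_y_pow_mul_unit_zpow (h : SMinusRels q l x y z) {w : A} {c : ℂ} (hz : z * w = w * z)
    (hw : w * y = c • (y * w)) (m : ℕ) (k : ℤ) :
    w * (y ^ m * (h.unit ^ k : Aˣ)) = c ^ m • (y ^ m * (h.unit ^ k : Aˣ) * w) := by
  have hk : Commute w (h.unit ^ k : Aˣ) :=
    Commute.units_zpow_right (show Commute w (h.unit : A) from hz.symm) k
  rw [← mul_assoc, mul_pow_of_mul_eq_smul hw, smul_mul_assoc, mul_assoc, hk.eq, ← mul_assoc]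

/-- The monomials span every algebra generated by elements satisfying the relations. -/
lemma span_monomial (h : SMinusRels q l x y z) (hq : q ≠ 0)
    (hgen : StarAlgebra.adjoin ℂ {x, y, z} = ⊤) :
    Submodule.span ℂ (Set.range (monomial h.unit x y)) = ⊤ := by
  set S := Submodule.span ℂ (Set.range (monomial h.unit x y)) with hS
  have mem (i) : monomial h.unit x y i ∈ S := Submodule.subset_span ⟨i, rfl⟩
  have hy : y ∈ S.leftStabilizer := mem_leftStabilizer_span fun ⟨m, k, n⟩ => by
    convert mem (m + 1, k, n) using 1
    simp only [monomial, pow_succ', mul_assoc]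
  have hyz (m : ℕ) : Commute z (y ^ m) := Commute.pow_right h.central_y m
  have hz : z ∈ S.leftStabilizer := mem_leftStabilizer_span fun ⟨m, k, n⟩ => by
    convert mem (m, 1 + k, n) using 1
    simp only [monomial, ← mul_assoc, zpow_add, zpow_one, Units.val_mul, (hyz m).eq]
    rfl
  have hzs : star z ∈ S.leftStabilizer := mem_leftStabilizer_span fun ⟨m, k, n⟩ => by
    convert mem (m, -1 + k, n) using 1
    have : Commute (h.unit⁻¹ : Aˣ).val (y ^ m) :=
      Commute.units_inv_left (show Commute (h.unit : A) _ from hyz m)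
    simp only [monomial, ← mul_assoc, zpow_add, zpow_neg, zpow_one, Units.val_mul, ← this.eq]
    rfl
  have hunit (k : ℤ) : ((h.unit ^ k : Aˣ) : A) ∈ S.leftStabilizer := by
    obtain ⟨n, rfl | rfl⟩ := k.eq_nat_or_neg
    · rw [zpow_natCast, Units.val_pow_eq_pow_val]
      exact pow_mem hz n
    · rw [zpow_neg, zpow_natCast, ← inv_pow, Units.val_pow_eq_pow_val]
      exact pow_mem hzs n
  have hpow (n : ℤ) : starPow x n ∈ S := by
    simpa [monomial] using mem (0, 0, n)
  have hprod (c : ℕ → ℂ) : ((List.range l).map fun p => 1 - c p • (y ^ 2 * z)).prod ∈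
      S.leftStabilizer := by
    refine Subalgebra.list_prod_mem _ fun a ha => ?_
    obtain ⟨p, -, rfl⟩ := List.mem_map.1 ha
    exact sub_mem (one_mem _) (Subalgebra.smul_mem _ (mul_mem (pow_mem hy 2) hz) _)
  have hx_pow (n : ℤ) : x * starPow x n ∈ S := by
    cases n with
    | ofNat n =>
      have := hpow (n + 1 : ℕ)
      rwa [starPow_natCast, pow_succ'] at this
    | negSucc n =>
      change x * star x ^ (n + 1) ∈ S
      rw [pow_succ', ← mul_assoc, h.rel_xxs]
      exact hprod _ _ (by simpa using hpow (-n))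
  have hxs_pow (n : ℤ) : star x * starPow x n ∈ S := by
    obtain ⟨n, rfl | rfl⟩ := n.eq_nat_or_neg
    · cases n with
      | zero =>
        have := hpow (-(1 : ℕ))
        rwa [starPow_neg_natCast, pow_one, ← mul_one (star x), ← starPow_zero x] at this
      | succ n =>
        rw [starPow_natCast, pow_succ', ← mul_assoc, h.rel_xsx]
        exact hprod _ _ (by simpa using hpow n)
    · have := hpow (-(n + 1 : ℕ))
      rwa [starPow_neg_natCast, pow_succ', ← starPow_neg_natCast] at this
  have hx : x ∈ S.leftStabilizer := mem_leftStabilizer_span fun ⟨m, k, n⟩ => by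
    rw [monomial, ← mul_assoc, h.mul_y_pow_mul_unit_zpow h.central_x h.rel_xy, smul_mul_assoc,
      mul_assoc]
    exact S.smul_mem _ (mul_mem (pow_mem hy m) (hunit k) _ (hx_pow n))
  have hxs : star x ∈ S.leftStabilizer := mem_leftStabilizer_span fun ⟨m, k, n⟩ => by
    rw [monomial, ← mul_assoc, h.mul_y_pow_mul_unit_zpow h.central_xs (h.star_x_mul_y hq),
      smul_mul_assoc, mul_assoc]
    exact S.smul_mem _ (mul_mem (pow_mem hy m) (hunit k) _ (hxs_pow n))
  have hys : star y ∈ S.leftStabilizer := by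
    rw [h.rel_ystar]
    exact mul_mem hy hz
  have htop : S.leftStabilizer = ⊤ := by
    rw [eq_top_iff, ← StarSubalgebra.top_toSubalgebra, ← hgen, StarAlgebra.adjoin_toSubalgebra,
      Algebra.adjoin_le_iff]
    rintro a (ha | ha)
    · rcases ha with rfl | rfl | rfl <;> assumption
    · rw [Set.mem_star] at ha
      rw [← star_star a]
      rcases ha with ha | ha | ha <;> rw [ha] <;> assumption
  refine eq_top_iff.2 fun a _ => ?_
  have ha : a ∈ S.leftStabilizer := htop ▸ Algebra.mem_top
  simpa using ha 1 (by simpa using hpow 0)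

end SMinusRels

/-- Elements satisfying the relations of `O(Σ_q³)` yield elements satisfying those of
`O(Σ_q³(l,−))`. -/
lemma SigmaRels.pow {A : Type} [Ring A] [Algebra ℂ A] [StarRing A] [StarModule ℂ A] {q : ℝ}
    {z0 z1 ξ : A} (h : SigmaRels q z0 z1 ξ) (hq : q ≠ 0) (l : ℕ) :
    SMinusRels q l (z0 ^ l) z1 ξ := by
  have hc : (q : ℂ) ≠ 0 := by exact_mod_cast hq
  have ht : z0 * (z1 ^ 2 * ξ) = (q : ℂ) ^ 2 • ((z1 ^ 2 * ξ) * z0) := by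
    rw [← mul_assoc, mul_pow_of_mul_eq_smul h.rel1, smul_mul_assoc, mul_assoc, ← h.central_z0,
      mul_assoc]
  have hcomm : Commute z1 ξ := h.central_z1.symm
  have hstar : star (z1 ^ 2 * ξ) = z1 ^ 2 * ξ := by
    have : (z1 * ξ) ^ 2 = ξ * (z1 ^ 2 * ξ) := by
      rw [hcomm.mul_pow, pow_two ξ, ← mul_assoc, (hcomm.pow_left 2).eq, mul_assoc,
        (hcomm.pow_left 2).eq]
    rw [star_mul, star_pow, h.rel5, this, ← mul_assoc, h.unitary', one_mul]
  set t := z1 ^ 2 * ξ with htdef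
  have hts : t * star z0 = (q : ℂ) ^ 2 • (star z0 * t) := by
    have h2 := congrArg star ht
    rwa [star_mul z0 t, star_smul, star_mul t z0, hstar, star_pow,
      show star (q : ℂ) = q from Complex.conj_ofReal q] at h2
  have ht' : t * z0 = ((q : ℂ)⁻¹ ^ 2) • (z0 * t) := by
    rw [ht, smul_smul, inv_pow, inv_mul_cancel₀ (pow_ne_zero 2 hc), one_smul]
  have hxx : z0 * star z0 = 1 - t := eq_sub_of_add_eq h.rel4
  have hsx : star z0 * z0 = 1 - ((q : ℂ)⁻¹ ^ 2) • t := by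
    have := h.rel3
    rw [hxx] at this
    rw [eq_sub_of_add_eq this.symm, sub_smul, one_smul]
    abel
  refine ⟨Commute.pow_right h.central_z0 l, h.central_z1, ?_, h.central_z1s, h.unitary,
    h.unitary', h.rel5, pow_mul_of_mul_eq_smul h.rel1 l, ?_, ?_⟩
  · rw [star_pow]
    exact Commute.pow_right h.central_z0s l
  · rw [star_pow]
    induction l with
    | zero => simp
    | succ l ih =>
      rw [List.range_succ, List.map_append, List.prod_append, ← ih, pow_succ, pow_succ',
        mul_assoc, ← mul_assoc z0, hxx, sub_mul, mul_pow_of_mul_eq_smul hts, one_mul, mul_sub]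
      simp only [List.map_cons, List.map_nil, List.prod_singleton, mul_sub, mul_one,
        mul_smul_comm, mul_assoc, pow_mul, ← htdef]
  · rw [star_pow]
    induction l with
    | zero => simp
    | succ l ih =>
      rw [List.range_succ, List.map_append, List.prod_append, ← ih, pow_succ, pow_succ',
        mul_assoc, ← mul_assoc (star z0), hsx, sub_mul, smul_mul_assoc,
        mul_pow_of_mul_eq_smul ht', one_mul, mul_sub]
      simp only [List.map_cons, List.map_nil, List.prod_singleton, mul_sub, mul_one,
        mul_smul_comm, mul_assoc, smul_smul]
      rw [← htdef, ← pow_succ', ← pow_mul]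

lemma StarAlgebra.adjoin_eq_top_of_comp_eq_id {A : Type} [Ring A] [Algebra ℂ A] [StarRing A]
    [StarModule ℂ A] {s : Set A}
    (h : ∃ f : A →⋆ₐ[ℂ] StarAlgebra.adjoin ℂ s,
      (StarAlgebra.adjoin ℂ s).subtype.comp f = StarAlgHom.id ℂ A) :
    StarAlgebra.adjoin ℂ s = ⊤ := by
  obtain ⟨f, hf⟩ := h
  refine StarSubalgebra.eq_top_iff.2 fun a => ?_
  have := DFunLike.congr_fun hf a
  rw [← show ((f a : StarAlgebra.adjoin ℂ s) : A) = a from this]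
  exact (f a).2

lemma SigmaAlg.adjoin_eq_top {q : ℝ} (P : SigmaAlg q) :
    StarAlgebra.adjoin ℂ {P.z0, P.z1, P.ξ} = ⊤ := by
  have mem {a : P.A} (ha : a ∈ ({P.z0, P.z1, P.ξ} : Set P.A)) :
      a ∈ StarAlgebra.adjoin ℂ {P.z0, P.z1, P.ξ} := StarAlgebra.subset_adjoin _ _ ha
  have hr := P.rels
  obtain ⟨f, ⟨h0, h1, hξ⟩, -⟩ := P.universal (StarAlgebra.adjoin ℂ {P.z0, P.z1, P.ξ})
    ⟨P.z0, mem (by simp)⟩ ⟨P.z1, mem (by simp)⟩ ⟨P.ξ, mem (by simp)⟩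
    ⟨Subtype.ext hr.1, Subtype.ext hr.2, Subtype.ext hr.3, Subtype.ext hr.4, Subtype.ext hr.5,
      Subtype.ext hr.6, Subtype.ext hr.7, Subtype.ext hr.8, Subtype.ext hr.9, Subtype.ext hr.10,
      Subtype.ext hr.11⟩
  refine StarAlgebra.adjoin_eq_top_of_comp_eq_id ⟨f, ?_⟩
  exact (P.universal P.A P.z0 P.z1 P.ξ hr).unique
    (by simp [h0, h1, hξ]) (by simp)

lemma SMinusAlg.adjoin_eq_top {q : ℝ} {l : ℕ} (P : SMinusAlg q l) :
    StarAlgebra.adjoin ℂ {P.x, P.y, P.z} = ⊤ := by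
  have mem {a : P.A} (ha : a ∈ ({P.x, P.y, P.z} : Set P.A)) :
      a ∈ StarAlgebra.adjoin ℂ {P.x, P.y, P.z} := StarAlgebra.subset_adjoin _ _ ha
  have hr := P.rels
  obtain ⟨f, ⟨hx, hy, hz⟩, -⟩ := P.universal (StarAlgebra.adjoin ℂ {P.x, P.y, P.z})
    ⟨P.x, mem (by simp)⟩ ⟨P.y, mem (by simp)⟩ ⟨P.z, mem (by simp)⟩
    ⟨Subtype.ext hr.1, Subtype.ext hr.2, Subtype.ext hr.3, Subtype.ext hr.4, Subtype.ext hr.5,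
      Subtype.ext hr.6, Subtype.ext hr.7, Subtype.ext hr.8,
      Subtype.val_injective (by
        change P.x * star P.x = (StarAlgebra.adjoin ℂ {P.x, P.y, P.z}).subtype _
        rw [hr.rel_xxs, map_list_prod, List.map_map]
        rfl),
      Subtype.val_injective (by
        change star P.x * P.x = (StarAlgebra.adjoin ℂ {P.x, P.y, P.z}).subtype _
        rw [hr.rel_xsx, map_list_prod, List.map_map]
        rfl)⟩
  refine StarAlgebra.adjoin_eq_top_of_comp_eq_id ⟨f, ?_⟩
  exact (P.universal P.A P.x P.y P.z hr).unique
    (by simp [hx, hy, hz]) (by simp)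

namespace SigmaModel

/-- The space underlying the regular representation of `O(Σ_q³)`: functions on the exponents
of its monomial basis, extended to negative powers of `ζ₁`. -/
abbrev Space : Type := ℤ × ℤ × ℤ → ℂ

/-- Complex conjugation of operators, with respect to the pointwise conjugation of functions. -/
def conj (T : Module.End ℂ Space) : Module.End ℂ Space where
  toFun v := star (T (star v))
  map_add' v w := by simp
  map_smul' c v := by simp

@[simp]
lemma conj_apply (T : Module.End ℂ Space) (v : Space) : conj T v = star (T (star v)) := rfl

/-- The *-algebra of pairs of operators, where the adjoint exchanges both operators up to complex
conjugation and the second factor carries the opposite multiplication. -/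
def Double : Type := Module.End ℂ Space × (Module.End ℂ Space)ᵐᵒᵖ

namespace Double

noncomputable instance : Ring Double :=
  inferInstanceAs (Ring (Module.End ℂ Space × (Module.End ℂ Space)ᵐᵒᵖ))

noncomputable instance : Algebra ℂ Double :=
  inferInstanceAs (Algebra ℂ (Module.End ℂ Space × (Module.End ℂ Space)ᵐᵒᵖ))

/-- The element of `Double` with the given components. -/
def mk (S T : Module.End ℂ Space) : Double := (S, MulOpposite.op T)

/-- The projection onto the first component. -/
noncomputable def fstHom : Double →ₐ[ℂ] Module.End ℂ Space :=
  AlgHom.fst ℂ (Module.End ℂ Space) (Module.End ℂ Space)ᵐᵒᵖ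

variable (S T S' T' : Module.End ℂ Space)

@[simp]
lemma fstHom_mk : fstHom (mk S T) = S := rfl

lemma mk_surjective (a : Double) : ∃ S T, a = mk S T := ⟨a.1, a.2.unop, rfl⟩

@[simp]
lemma mk_mul_mk : mk S T * mk S' T' = mk (S * S') (T' * T) := rfl

@[simp]
lemma mk_add_mk : mk S T + mk S' T' = mk (S + S') (T + T') := rfl

@[simp]
lemma smul_mk (c : ℂ) : c • mk S T = mk (c • S) (c • T) := rfl

lemma one_eq_mk : (1 : Double) = mk 1 1 := rfl

noncomputable instance : StarRing Double where
  star a := mk (conj a.2.unop) (conj a.1)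
  star_involutive a := by
    obtain ⟨S, T, rfl⟩ := mk_surjective a
    change mk (conj (conj S)) (conj (conj T)) = mk S T
    congr 1 <;> ext1 <;> simp
  star_mul a b := by
    obtain ⟨S, T, rfl⟩ := mk_surjective a
    obtain ⟨S', T', rfl⟩ := mk_surjective b
    change mk (conj (T' * T)) (conj (S * S')) = mk (conj T' * conj T) (conj S * conj S')
    congr 1 <;> ext1 <;> simp
  star_add a b := by
    obtain ⟨S, T, rfl⟩ := mk_surjective a
    obtain ⟨S', T', rfl⟩ := mk_surjective b
    change mk (conj (T + T')) (conj (S + S')) = mk (conj T + conj T') (conj S + conj S')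
    congr 1 <;> ext1 <;> simp

lemma star_mk : star (mk S T) = mk (conj T) (conj S) := rfl

instance : StarModule ℂ Double where
  star_smul c a := by
    obtain ⟨S, T, rfl⟩ := mk_surjective a
    rw [smul_mk, star_mk, star_mk, smul_mk]
    congr 1 <;> ext1 <;> simp

end Double

/-- The operator by which `ζ₀` acts. -/
noncomputable def opZ0 (q : ℝ) : Module.End ℂ Space where
  toFun v i := (q : ℂ) ^ i.1 * v (i.1, i.2.1, i.2.2 - 1) -
    if i.2.2 ≤ 0 then (q : ℂ) ^ (i.1 - 2) * v (i.1 - 2, i.2.1 - 1, i.2.2 - 1) else 0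
  map_add' v w := by
    ext i
    simp only [Pi.add_apply]
    split_ifs <;> ring
  map_smul' c v := by
    ext i
    simp only [Pi.smul_apply, smul_eq_mul, RingHom.id_apply]
    split_ifs <;> ring

/-- The operator by which `ζ₀*` acts. -/
noncomputable def opZ0Star (q : ℝ) : Module.End ℂ Space where
  toFun v i := ((q : ℂ) ^ i.1)⁻¹ * (v (i.1, i.2.1, i.2.2 + 1) -
    if 0 ≤ i.2.2 then v (i.1 - 2, i.2.1 - 1, i.2.2 + 1) else 0)
  map_add' v w := by
    ext i
    simp only [Pi.add_apply]
    split_ifs <;> ring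
  map_smul' c v := by
    ext i
    simp only [Pi.smul_apply, smul_eq_mul, RingHom.id_apply]
    split_ifs <;> ring

/-- The operator translating the first two exponents; `ζ₁` acts by `opShift 1 0`
and `ξ` by `opShift 0 1`. -/
def opShift (a b : ℤ) : Module.End ℂ Space where
  toFun v i := v (i.1 - a, i.2.1 - b, i.2.2)
  map_add' _ _ := rfl
  map_smul' _ _ := rfl

lemma conj_opZ0 (q : ℝ) : conj (opZ0 q) = opZ0 q := by
  ext v i
  simp only [conj_apply, opZ0, LinearMap.coe_mk, AddHom.coe_mk, Pi.star_apply]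
  split_ifs <;> simp

lemma conj_opZ0Star (q : ℝ) : conj (opZ0Star q) = opZ0Star q := by
  ext v i
  simp only [conj_apply, opZ0Star, LinearMap.coe_mk, AddHom.coe_mk, Pi.star_apply]
  split_ifs <;> simp

lemma conj_opShift (a b : ℤ) : conj (opShift a b) = opShift a b := by
  ext v i
  simp [opShift]

lemma opShift_mul_opShift (a b c d : ℤ) :
    opShift a b * opShift c d = opShift (a + c) (b + d) := by
  ext v i
  simp [opShift, sub_sub]

lemma opShift_zero : opShift 0 0 = 1 := by
  ext v i
  simp [opShift]

lemma opZ0_mul_opShift {q : ℝ} (hq : q ≠ 0) (a b : ℤ) :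
    opZ0 q * opShift a b = (q : ℂ) ^ a • (opShift a b * opZ0 q) := by
  have hc : (q : ℂ) ≠ 0 := by exact_mod_cast hq
  ext v ⟨m, k, n⟩
  simp only [opZ0, opShift, Module.End.mul_apply, LinearMap.smul_apply, Pi.smul_apply,
    LinearMap.coe_mk, AddHom.coe_mk, smul_eq_mul, zpow_sub₀ hc, sub_right_comm _ _ a,
    sub_right_comm _ _ b]
  split_ifs <;> field_simp
  ring

lemma opShift_mul_opZ0Star {q : ℝ} (hq : q ≠ 0) (a b : ℤ) :
    opShift a b * opZ0Star q = (q : ℂ) ^ a • (opZ0Star q * opShift a b) := by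
  have hc : (q : ℂ) ≠ 0 := by exact_mod_cast hq
  ext v ⟨m, k, n⟩
  simp only [opZ0Star, opShift, Module.End.mul_apply, LinearMap.smul_apply, Pi.smul_apply,
    LinearMap.coe_mk, AddHom.coe_mk, smul_eq_mul, zpow_sub₀ hc, sub_right_comm _ _ a,
    sub_right_comm _ _ b]
  split_ifs <;> field_simp

lemma opZ0_mul_opZ0Star {q : ℝ} (hq : q ≠ 0) :
    opZ0 q * opZ0Star q + opShift 2 1 = 1 := by
  have hc : (q : ℂ) ≠ 0 := by exact_mod_cast hq
  ext v ⟨m, k, n⟩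
  simp only [opZ0, opZ0Star, opShift, Module.End.mul_apply, LinearMap.add_apply, Pi.add_apply,
    LinearMap.coe_mk, AddHom.coe_mk, Module.End.one_apply, zpow_sub₀ hc, sub_add_cancel]
  split_ifs <;> first | omega | (field_simp; ring)

lemma opZ0Star_mul_opZ0 {q : ℝ} (hq : q ≠ 0) :
    opZ0Star q * opZ0 q + ((q : ℂ)⁻¹ ^ 2) • opShift 2 1 = 1 := by
  have hc : (q : ℂ) ≠ 0 := by exact_mod_cast hq
  ext v ⟨m, k, n⟩
  simp only [opZ0, opZ0Star, opShift, Module.End.mul_apply, LinearMap.add_apply, Pi.add_apply,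
    LinearMap.smul_apply, Pi.smul_apply, smul_eq_mul,
    LinearMap.coe_mk, AddHom.coe_mk, Module.End.one_apply, zpow_sub₀ hc, add_sub_cancel_right]
  split_ifs <;> first | omega | (field_simp; ring)

lemma sigmaRels {q : ℝ} (hq : q ≠ 0) :
    SigmaRels q (Double.mk (opZ0 q) (opZ0Star q)) (Double.mk (opShift 1 0) (opShift 1 1))
      (Double.mk (opShift 0 1) (opShift 0 (-1))) := by
  have h0 (a b : ℤ) := opZ0_mul_opShift hq a b
  have h0s (a b : ℤ) := opShift_mul_opZ0Star hq a b
  have hxx : opZ0 q * opZ0Star q = 1 - opShift 2 1 :=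
    eq_sub_of_add_eq (opZ0_mul_opZ0Star hq)
  have hsx : opZ0Star q * opZ0 q = 1 - ((q : ℂ)⁻¹ ^ 2) • opShift 2 1 :=
    eq_sub_of_add_eq (opZ0Star_mul_opZ0 hq)
  constructor <;>
    simp only [Double.star_mk, Double.mk_mul_mk, Double.mk_add_mk, Double.smul_mk,
      Double.one_eq_mk, conj_opZ0, conj_opZ0Star, conj_opShift, opShift_mul_opShift,
      h0, h0s, pow_two (Double.mk (opShift 1 0) (opShift 1 1)), hxx, hsx] <;>
    norm_num [opShift_zero]
  congr 1 <;> module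

/-- The indicator function of an exponent. -/
def basis (i : ℤ × ℤ × ℤ) : Space := Pi.single i 1

lemma opShift_basis (a b m k n : ℤ) :
    opShift a b (basis (m, k, n)) = basis (m + a, k + b, n) := by
  ext ⟨m', k', n'⟩
  simp [opShift, basis, Pi.single_apply, sub_eq_iff_eq_add]

lemma opZ0_basis (q : ℝ) (n : ℕ) : opZ0 q (basis (0, 0, n)) = basis (0, 0, (n + 1 : ℕ)) := by
  ext ⟨m', k', n'⟩
  have : n' ≤ 0 → n' - 1 ≠ n := by omega
  simp only [opZ0, basis, Pi.single_apply, LinearMap.coe_mk, AddHom.coe_mk, Prod.mk.injEq,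
    sub_eq_iff_eq_add]
  push_cast
  split_ifs <;> simp_all
  omega

lemma opZ0Star_basis (q : ℝ) (n : ℕ) :
    opZ0Star q (basis (0, 0, -n)) = basis (0, 0, -(n + 1 : ℕ)) := by
  ext ⟨m', k', n'⟩
  have h1 : 0 ≤ n' → n' + 1 ≠ -n := by omega
  have h2 : n' + 1 = -n ↔ n' = -(n + 1) := by omega
  simp only [opZ0Star, basis, Pi.single_apply, LinearMap.coe_mk, AddHom.coe_mk, Prod.mk.injEq]
  push_cast
  split_ifs <;> simp_all

end SigmaModel

open SigmaModel in
/-- Applied to the unit basis vector, the regular representation maps the monomials of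
`O(Σ_q³)` to distinct basis vectors. -/
lemma SigmaAlg.exists_linearMap_monomial {q : ℝ} (hq : q ≠ 0) (P : SigmaAlg q) (u : P.Aˣ)
    (hu : (u : P.A) = P.ξ) :
    ∃ g : P.A →ₗ[ℂ] Space, ∀ i : ℕ × ℤ × ℤ,
      g (monomial u P.z0 P.z1 i) = basis (i.1, i.2.1, i.2.2) := by
  obtain ⟨f, ⟨h0, h1, hξ⟩, -⟩ := P.universal Double _ _ _ (sigmaRels hq)
  let π : P.A →ₐ[ℂ] Module.End ℂ Space := Double.fstHom.comp f.toAlgHom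
  have hπ (a : P.A) : π a = Double.fstHom (f a) := rfl
  have hz0 : π P.z0 = opZ0 q := by simp [hπ, h0]
  have hz0s : π (star P.z0) = opZ0Star q := by
    simp [hπ, map_star, h0, Double.star_mk, conj_opZ0Star]
  have hz1 : π P.z1 = opShift 1 0 := by simp [hπ, h1]
  have hu1 : π u = opShift 0 1 := by simp [hπ, hu, hξ]
  have hu2 : π (u⁻¹ : P.Aˣ) = opShift 0 (-1) := by
    have h : π (u⁻¹ : P.Aˣ) * opShift 0 1 = 1 := by
      rw [← hu1, ← map_mul, Units.inv_mul, map_one]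
    calc π (u⁻¹ : P.Aˣ) = π (u⁻¹ : P.Aˣ) * opShift 0 1 * opShift 0 (-1) := by
          rw [mul_assoc, opShift_mul_opShift]
          simp [opShift_zero]
      _ = opShift 0 (-1) := by rw [h, one_mul]
  have hpow (n : ℤ) : π (starPow P.z0 n) (basis (0, 0, 0)) = basis (0, 0, n) := by
    obtain ⟨n, rfl | rfl⟩ := n.eq_nat_or_neg
    · induction n with
      | zero => simp
      | succ n ih =>
        rw [starPow_natCast] at ih ⊢
        rw [pow_succ', map_mul, Module.End.mul_apply, ih, hz0, opZ0_basis]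
    · induction n with
      | zero => simp
      | succ n ih =>
        rw [starPow_neg_natCast] at ih ⊢
        rw [pow_succ', map_mul, Module.End.mul_apply, ih, hz0s, opZ0Star_basis]
  have hzpow (k n : ℤ) : π (u ^ k : P.Aˣ) (basis (0, 0, n)) = basis (0, k, n) := by
    induction k with
    | zero => simp
    | succ k ih =>
      rw [add_comm, zpow_add, Units.val_mul, map_mul, Module.End.mul_apply, ih, zpow_one, hu1,
        opShift_basis, add_zero, add_comm]
    | pred k ih =>
      rw [sub_eq_add_neg, add_comm, zpow_add, Units.val_mul, map_mul, Module.End.mul_apply, ih,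
        zpow_neg, zpow_one, hu2, opShift_basis, add_zero, add_comm]
  have hz1pow (m : ℕ) (k n : ℤ) : π (P.z1 ^ m) (basis (0, k, n)) = basis (m, k, n) := by
    induction m with
    | zero => simp
    | succ m ih =>
      rw [pow_succ', map_mul, Module.End.mul_apply, ih, hz1, opShift_basis, add_zero,
        Nat.cast_succ]
  refine ⟨(LinearMap.applyₗ (basis (0, 0, 0))).comp π.toLinearMap, fun i => ?_⟩
  simp only [monomial, LinearMap.comp_apply, LinearMap.applyₗ_apply_apply, AlgHom.toLinearMap_apply,
    map_mul, Module.End.mul_apply, hpow, hzpow, hz1pow]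

/-- The *-endomorphism of `O(Σ_q³)` scaling `ζ₀` by a complex number of modulus one. -/
lemma SigmaAlg.exists_scale {q : ℝ} (P : SigmaAlg q) {ω : ℂ} (hω : ω * star ω = 1) :
    ∃ φ : P.A →⋆ₐ[ℂ] P.A, φ P.z0 = ω • P.z0 ∧ φ P.z1 = P.z1 ∧ φ P.ξ = P.ξ := by
  have h := P.rels
  have hω' : star ω * ω = 1 := by rw [mul_comm, hω]
  obtain ⟨φ, hφ, -⟩ := P.universal P.A (ω • P.z0) P.z1 P.ξ
    { central_z0 := by rw [mul_smul_comm, smul_mul_assoc, h.central_z0]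
      central_z1 := h.central_z1
      central_z0s := by rw [star_smul, mul_smul_comm, smul_mul_assoc, h.central_z0s]
      central_z1s := h.central_z1s
      unitary := h.unitary
      unitary' := h.unitary'
      rel1 := by rw [mul_smul_comm, smul_mul_assoc, h.rel1, smul_comm]
      rel2 := by rw [mul_smul_comm, smul_mul_assoc, h.rel2, smul_comm]
      rel3 := by
        rw [star_smul, smul_mul_smul_comm, smul_mul_smul_comm, hω, hω', one_smul, one_smul, h.rel3]
      rel4 := by rw [star_smul, smul_mul_smul_comm, hω, one_smul, h.rel4]
      rel5 := h.rel5 }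
  exact ⟨φ, hφ⟩

lemma AddChar.mul_star_eq_one {l : ℕ} [NeZero l] (ψ : AddChar (ZMod l) ℂ) (i : ZMod l) :
    ψ i * star (ψ i) = 1 := by
  rw [← starRingEnd_apply, ← AddChar.map_neg_eq_conj, ← AddChar.map_add_eq_mul, add_neg_cancel,
    AddChar.map_zero_eq_one]

lemma starPow_smul {A : Type*} [Ring A] [Algebra ℂ A] [StarRing A] [StarModule ℂ A] {l : ℕ}
    [NeZero l] (ψ : AddChar (ZMod l) ℂ) (x : A) (n : ℤ) :
    starPow (ψ 1 • x) n = ψ n • starPow x n := by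
  obtain ⟨n, rfl | rfl⟩ := n.eq_nat_or_neg
  · rw [starPow_natCast, starPow_natCast, smul_pow, ← AddChar.map_nsmul_eq_pow]
    simp
  · rw [starPow_neg_natCast, starPow_neg_natCast, star_smul, smul_pow, ← starRingEnd_apply,
      ← AddChar.map_neg_eq_conj, ← AddChar.map_nsmul_eq_pow]
    simp

lemma SMinusAlg.injective_of_linearIndependent {q : ℝ} {l : ℕ} (hq : q ≠ 0) (P : SMinusAlg q l)
    {V : Type*} [AddCommGroup V] [Module ℂ V] (g : P.A →ₗ[ℂ] V)
    (h : LinearIndependent ℂ (g ∘ monomial P.rels.unit P.x P.y)) : Function.Injective g := by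
  refine (injective_iff_map_eq_zero g).2 fun a ha => ?_
  have : a ∈ Submodule.span ℂ (Set.range (monomial P.rels.unit P.x P.y)) := by
    rw [P.rels.span_monomial hq P.adjoin_eq_top]
    trivial
  obtain ⟨c, rfl⟩ := Finsupp.mem_span_range_iff_exists_finsupp.1 this
  have hc : c = 0 := linearIndependent_iff.1 h c (by
    rw [← ha, Finsupp.linearCombination_apply]
    simp [Finsupp.sum, map_sum])
  simp [hc]

lemma SigmaModel.linearIndependent_basis : LinearIndependent ℂ SigmaModel.basis :=
  Pi.linearIndependent_single_one _ ℂ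

/-- let `l` be a positive integer.  There is a `ℤ/lℤ`-grading of `O(Σ_q³)`
(a *-algebra grading `𝒜` with internal direct sum decomposition) determined by assigning
degree `1 (mod l)` to `ζ₀` and degree `0` to `ζ₁` and `ξ`.  Its degree-zero component
equals the *-subalgebra generated by `ζ₀^l, ζ₁, ξ`, and `x ↦ ζ₀^l`, `y ↦ ζ₁`, `z ↦ ξ`
defines a *-algebra isomorphism from `O(Σ_q³(l,−))` onto this degree-zero component
(an injective *-algebra homomorphism with range the degree-zero component). -/
theorem sigma_zmod_grading_fixed_points (q : ℝ) (hq0 : 0 < q) (hq1 : q < 1)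
    (l : ℕ) (hl : 0 < l) (P : SigmaAlg q) (Pm : SMinusAlg q l) :
    ∃ 𝒜 : ZMod l → Submodule ℂ P.A,
      (1 : P.A) ∈ 𝒜 0 ∧
      (∀ (i j : ZMod l), ∀ a ∈ 𝒜 i, ∀ b ∈ 𝒜 j, a * b ∈ 𝒜 (i + j)) ∧
      (∀ (i : ZMod l), ∀ a ∈ 𝒜 i, star a ∈ 𝒜 (-i)) ∧
      DirectSum.IsInternal 𝒜 ∧
      P.z0 ∈ 𝒜 1 ∧ P.z1 ∈ 𝒜 0 ∧ P.ξ ∈ 𝒜 0 ∧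
      (𝒜 0 : Set P.A) =
        (StarAlgebra.adjoin ℂ {P.z0 ^ l, P.z1, P.ξ} : StarSubalgebra ℂ P.A) ∧
      ∃ f : Pm.A →⋆ₐ[ℂ] P.A,
        Function.Injective f ∧ Set.range f = (𝒜 0 : Set P.A) ∧
        f Pm.x = P.z0 ^ l ∧ f Pm.y = P.z1 ∧ f Pm.z = P.ξ := by
  have : NeZero l := ⟨hl.ne'⟩
  have hq : q ≠ 0 := hq0.ne'
  have hrels : SMinusRels q l (P.z0 ^ l) P.z1 P.ξ := P.rels.pow hq l
  have hrels1 : SMinusRels q 1 P.z0 P.z1 P.ξ := by simpa using P.rels.pow hq 1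
  have hspan := hrels1.span_monomial hq P.adjoin_eq_top
  set u := hrels1.unit
  have huξ : (u : P.A) = P.ξ := rfl
  obtain ⟨f, ⟨hfx, hfy, hfz⟩, -⟩ := Pm.universal P.A _ _ _ hrels
  have hrange : f.range = StarAlgebra.adjoin ℂ {P.z0 ^ l, P.z1, P.ξ} := by
    rw [StarAlgHom.range_eq_map_top, ← Pm.adjoin_eq_top, StarAlgHom.map_adjoin]
    simp [Set.image_insert_eq, hfx, hfy, hfz]
  have hf_mon (i : ℕ × ℤ × ℤ) : f (monomial Pm.rels.unit Pm.x Pm.y i) =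
      monomial u P.z0 P.z1 (i.1, i.2.1, l * i.2.2) := by
    rw [map_monomial f (u' := u) (by rw [huξ, ← hfz]; rfl), hfx, hfy, monomial, starPow_pow]
    rfl
  let ψ : AddChar (ZMod l) ℂ := ZMod.stdAddChar
  obtain ⟨φ, hφ0, hφ1, hφξ⟩ := P.exists_scale (AddChar.mul_star_eq_one ψ 1)
  let 𝒜 : ZMod l → Submodule ℂ P.A := fun i =>
    Module.End.eigenspace (φ.toAlgHom.toLinearMap : Module.End ℂ P.A) (ψ i)
  have mem (i : ZMod l) (a : P.A) : a ∈ 𝒜 i ↔ φ a = ψ i • a := Module.End.mem_eigenspace_iff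
  have mem0 (a : P.A) : a ∈ 𝒜 0 ↔ φ a = a := by simp [mem]
  have hmon (i : ℕ × ℤ × ℤ) : monomial u P.z0 P.z1 i ∈ 𝒜 (i.2.2 : ℤ) := by
    rw [mem, map_monomial φ (u' := u) (by rw [huξ, hφξ]), hφ0, hφ1, monomial, starPow_smul,
      mul_smul_comm]
    rfl
  have hindep : iSupIndep 𝒜 :=
    (Module.End.eigenspaces_iSupIndep _).comp ZMod.injective_stdAddChar
  have hle : (StarAlgebra.adjoin ℂ {P.z0 ^ l, P.z1, P.ξ}).toSubalgebra.toSubmodule ≤ 𝒜 0 := by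
    have : StarAlgebra.adjoin ℂ {P.z0 ^ l, P.z1, P.ξ} ≤
        StarAlgHom.equalizer φ (StarAlgHom.id ℂ P.A) := by
      refine StarAlgHom.adjoin_le_equalizer _ _ ?_
      rintro a (rfl | rfl | rfl)
      · change φ (P.z0 ^ l) = P.z0 ^ l
        rw [map_pow, hφ0, smul_pow, ← AddChar.map_nsmul_eq_pow]
        simp
      · exact hφ1
      · exact hφξ
    exact fun a ha => (mem0 a).2 (this ha)
  have hmon0 (i : ℕ × ℤ × ℤ) (hi : (i.2.2 : ZMod l) = 0) : monomial u P.z0 P.z1 i ∈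
      (StarAlgebra.adjoin ℂ {P.z0 ^ l, P.z1, P.ξ}).toSubalgebra.toSubmodule := by
    obtain ⟨m, k, n⟩ := i
    obtain ⟨n, rfl⟩ := (ZMod.intCast_zmod_eq_zero_iff_dvd _ _).1 hi
    rw [← hf_mon (m, k, n), ← hrange]
    exact ⟨_, rfl⟩
  have htop : (StarAlgebra.adjoin ℂ {P.z0 ^ l, P.z1, P.ξ}).toSubalgebra.toSubmodule ⊔
      ⨆ j ≠ 0, 𝒜 j = ⊤ := by
    rw [eq_top_iff, ← hspan, Submodule.span_le]
    rintro _ ⟨i, rfl⟩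
    by_cases hi : (i.2.2 : ZMod l) = 0
    · exact Submodule.mem_sup_left (hmon0 i hi)
    · exact Submodule.mem_sup_right
        (Submodule.mem_iSup_of_mem _ (Submodule.mem_iSup_of_mem hi (hmon i)))
  have hzero : 𝒜 0 = (StarAlgebra.adjoin ℂ {P.z0 ^ l, P.z1, P.ξ}).toSubalgebra.toSubmodule :=
    (eq_of_le_of_inf_le_of_le_sup hle ((hindep 0).eq_bot.trans_le bot_le)
      (htop ▸ le_top)).symm
  have hzero' : (𝒜 0 : Set P.A) = StarAlgebra.adjoin ℂ {P.z0 ^ l, P.z1, P.ξ} := by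
    rw [hzero]
    rfl
  refine ⟨𝒜, by simp [mem0], fun i j a ha b hb => ?_, fun i a ha => ?_, ?_, (mem _ _).2 hφ0,
    (mem0 _).2 hφ1, (mem0 _).2 hφξ, hzero', f, ?_, ?_, hfx, hfy, hfz⟩
  · rw [mem] at *
    rw [map_mul, ha, hb, smul_mul_smul_comm, AddChar.map_add_eq_mul]
  · rw [mem] at *
    rw [map_star, ha, star_smul, AddChar.map_neg_eq_conj, starRingEnd_apply]
  · rw [DirectSum.isInternal_submodule_iff_iSupIndep_and_iSup_eq_top]
    refine ⟨hindep, ?_⟩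
    rw [eq_top_iff, ← hspan, Submodule.span_le]
    rintro _ ⟨i, rfl⟩
    exact Submodule.mem_iSup_of_mem _ (hmon i)
  · obtain ⟨g, hg⟩ := P.exists_linearMap_monomial hq u huξ
    have hinj : Function.Injective (g.comp f.toAlgHom.toLinearMap) := by
      refine Pm.injective_of_linearIndependent hq _ ?_
      have hcomp : g.comp f.toAlgHom.toLinearMap ∘ monomial Pm.rels.unit Pm.x Pm.y =
          SigmaModel.basis ∘ fun i : ℕ × ℤ × ℤ => ((i.1 : ℤ), i.2.1, l * i.2.2) := by
        funext i
        change g (f _) = _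
        rw [hf_mon, hg]
        rfl
      rw [hcomp]
      refine SigmaModel.linearIndependent_basis.comp _ ?_
      rintro ⟨m, k, n⟩ ⟨m', k', n'⟩ h
      simpa [hl.ne'] using h
    exact Function.Injective.of_comp hinj
  · rw [hzero', ← hrange]
    rfl
end

section
/- Equip O(Σ_q³(l,−)) with the ℤ-grading determined by deg x = 1, deg y = 1, deg z = −2, with homogeneous components A_n. Then for every n ∈ ℤ, the identity element 1 lies in the linear span of the products {pr : p ∈ A_{−n}, r ∈ A_n}. Consequently the grading is strong (A_m·A_n spans A_{m+n} for all m,n), i.e. the corresponding ℂ[u,u*]-coaction on O(Σ_q³(l,−)) is Hopf–Galois over its degree-zero subalgebra. -/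
section GradedProducts

variable {R A : Type*} [CommRing R] [Ring A] [Algebra R A] {𝒜 : ℤ → Submodule R A}

theorem one_mem_mul_nsmul_of_one_mem_mul (hone : (1 : A) ∈ 𝒜 0)
    (hle : ∀ m n, 𝒜 m * 𝒜 n ≤ 𝒜 (m + n)) {d : ℤ} (hd : (1 : A) ∈ 𝒜 (-d) * 𝒜 d) (k : ℕ) :
    (1 : A) ∈ 𝒜 (-(k * d)) * 𝒜 (k * d) := by
  induction k with
  | zero => simpa using Submodule.mul_mem_mul hone hone
  | succ k ih =>
    have hsub : 𝒜 (-d) * 1 * 𝒜 d ≤ 𝒜 (-((k + 1 : ℕ) * d)) * 𝒜 ((k + 1 : ℕ) * d) :=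
      calc 𝒜 (-d) * 1 * 𝒜 d
          ≤ 𝒜 (-d) * (𝒜 (-(k * d)) * 𝒜 (k * d)) * 𝒜 d := by
            gcongr
            exact Submodule.one_le.2 ih
        _ = (𝒜 (-d) * 𝒜 (-(k * d))) * (𝒜 (k * d) * 𝒜 d) := by simp only [mul_assoc]
        _ ≤ 𝒜 (-d + -(k * d)) * 𝒜 (k * d + d) := mul_le_mul' (hle _ _) (hle _ _)
        _ = _ := by congr 2 <;> push_cast <;> ring
    exact hsub (by rwa [mul_one])

theorem mul_eq_of_one_mem_mul (hle : ∀ m n, 𝒜 m * 𝒜 n ≤ 𝒜 (m + n))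
    (h : ∀ n, (1 : A) ∈ 𝒜 (-n) * 𝒜 n) (m n : ℤ) : 𝒜 m * 𝒜 n = 𝒜 (m + n) := by
  refine le_antisymm (hle m n) ?_
  calc 𝒜 (m + n) = 𝒜 (m + n) * 1 := (mul_one _).symm
    _ ≤ 𝒜 (m + n) * (𝒜 (-n) * 𝒜 n) := by
      gcongr
      exact Submodule.one_le.2 (h n)
    _ = 𝒜 (m + n) * 𝒜 (-n) * 𝒜 n := (mul_assoc _ _ _).symm
    _ ≤ 𝒜 (m + n + -n) * 𝒜 n := by
      gcongr
      exact hle _ _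
    _ = 𝒜 m * 𝒜 n := by rw [add_neg_cancel_right]

theorem exists_list_prod_one_sub_smul_eq (S : Subalgebra R A) {w : A} (hw : w ∈ S)
    {ι : Type*} (c : ι → R) (L : List ι) :
    ∃ g ∈ S, (L.map fun p => 1 - c p • w).prod = 1 - g * w := by
  induction L with
  | nil => exact ⟨0, S.zero_mem, by simp⟩
  | cons p L ih =>
    obtain ⟨g, hg, hL⟩ := ih
    refine ⟨algebraMap R A (c p) + g - c p • (w * g),
      S.sub_mem (S.add_mem (S.algebraMap_mem _) hg) (S.smul_mem (S.mul_mem hw hg) _), ?_⟩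
    rw [List.map_cons, List.prod_cons, hL]
    simp only [sub_mul, mul_sub, add_mul, one_mul, mul_one, smul_mul_assoc, mul_assoc,
      ← Algebra.smul_def]
    abel

theorem one_mem_mul_of_mul_eq_one_sub {d e : ℤ} {a b u v g : A}
    (hle : ∀ m n, 𝒜 m * 𝒜 n ≤ 𝒜 (m + n)) (ha : a ∈ 𝒜 d) (hb : b ∈ 𝒜 e)
    (hu : u ∈ 𝒜 d) (hv : v ∈ 𝒜 e) (hg : g ∈ 𝒜 0) (h : a * b = 1 - g * (u * v)) :
    (1 : A) ∈ 𝒜 d * 𝒜 e := by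
  have h1 : (1 : A) = a * b + g * u * v := by rw [h, mul_assoc, sub_add_cancel]
  rw [h1]
  refine add_mem (Submodule.mul_mem_mul ha hb) (Submodule.mul_mem_mul ?_ hv)
  simpa using hle 0 d (Submodule.mul_mem_mul hg hu)

end GradedProducts

/-- equip `O(Σ_q³(l,−))` with the ℤ-grading determined by `deg x = 1`,
`deg y = 1`, `deg z = −2` (a *-algebra grading `𝒜` with internal direct sum
decomposition and the stated degrees of the generators).  Then for every `n ∈ ℤ` the
identity `1` lies in the span of the products `𝒜_{−n} · 𝒜_n`; consequently the grading
is strong — `𝒜_m · 𝒜_n` spans `𝒜_{m+n}` for all `m, n` — i.e. the corresponding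
`ℂ[u,u*]`-coaction on `O(Σ_q³(l,−))` is Hopf–Galois over its degree-zero subalgebra. -/
theorem sminus_grading_strong (q : ℝ) (hq0 : 0 < q) (hq1 : q < 1)
    (l : ℕ) (hl : 0 < l) (Pm : SMinusAlg q l) (𝒜 : ℤ → Submodule ℂ Pm.A)
    (hone : (1 : Pm.A) ∈ 𝒜 0)
    (hmul : ∀ (m n : ℤ), ∀ a ∈ 𝒜 m, ∀ b ∈ 𝒜 n, a * b ∈ 𝒜 (m + n))
    (hstar : ∀ (n : ℤ), ∀ a ∈ 𝒜 n, star a ∈ 𝒜 (-n))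
    (hdec : DirectSum.IsInternal 𝒜)
    (hx : Pm.x ∈ 𝒜 1) (hy : Pm.y ∈ 𝒜 1) (hz : Pm.z ∈ 𝒜 (-2)) :
    (∀ n : ℤ, (1 : Pm.A) ∈ 𝒜 (-n) * 𝒜 n) ∧
      (∀ m n : ℤ, 𝒜 m * 𝒜 n = 𝒜 (m + n)) := by
  have hle : ∀ m n, 𝒜 m * 𝒜 n ≤ 𝒜 (m + n) := fun m n => Submodule.mul_le.2 (hmul m n)
  have hR := Pm.rels
  let S : Subalgebra ℂ Pm.A := (𝒜 0).toSubalgebra hone fun a b ha hb => by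
    simpa using hmul 0 0 a ha b hb
  have hw : Pm.y ^ 2 * Pm.z ∈ S := by
    simpa [S, pow_two] using hmul _ _ _ (hmul _ _ _ hy _ hy) _ hz
  have hw₁ : Pm.y ^ 2 * Pm.z = star Pm.y * Pm.y := by
    rw [hR.rel_ystar, mul_assoc, hR.central_y, pow_two, mul_assoc]
  have hw₂ : Pm.y ^ 2 * Pm.z = Pm.y * star Pm.y := by
    rw [hR.rel_ystar, pow_two, mul_assoc]
  have h_neg : (1 : Pm.A) ∈ 𝒜 (-1) * 𝒜 1 := by
    obtain ⟨g, hg, h⟩ := exists_list_prod_one_sub_smul_eq S hw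
      (fun p => ((q : ℂ)⁻¹) ^ (2 * (p + 1))) (List.range l)
    exact one_mem_mul_of_mul_eq_one_sub hle (hstar 1 _ hx) hx (hstar 1 _ hy) hy hg
      (by rw [← hw₁, hR.rel_xsx, h])
  have h_pos : (1 : Pm.A) ∈ 𝒜 (- -1) * 𝒜 (-1) := by
    obtain ⟨g, hg, h⟩ := exists_list_prod_one_sub_smul_eq S hw
      (fun p => (q : ℂ) ^ (2 * p)) (List.range l)
    rw [neg_neg]
    exact one_mem_mul_of_mul_eq_one_sub hle hx (hstar 1 _ hx) hy (hstar 1 _ hy) hg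
      (by rw [← hw₂, hR.rel_xxs, h])
  have h_one : ∀ n : ℤ, (1 : Pm.A) ∈ 𝒜 (-n) * 𝒜 n := by
    intro n
    obtain ⟨k, rfl | rfl⟩ := n.eq_nat_or_neg
    · simpa using one_mem_mul_nsmul_of_one_mem_mul hone hle h_neg k
    · simpa using one_mem_mul_nsmul_of_one_mem_mul hone hle h_pos k
  exact ⟨h_one, mul_eq_of_one_mem_mul hle h_one⟩
end

section
/- Every invertible element of O(Σ_q³(l,−)) is a nonzero scalar multiple of zⁿ for some n ∈ ℤ. In particular, for the ℤ-grading with deg x = 1, deg y = 1, deg z = −2, the algebra O(Σ_q³(l,−)) contains no invertible element of degree 1, and hence the corresponding ℂ[u,u*]-comodule algebra O(Σ_q³(l,−)) is non-cleft. -/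
namespace SMinus

/-- If a product of two finitely supported families, twisted by `c`, is a monomial, then so are
both factors. -/
theorem eq_single_of_twisted_mul_eq_single {G M N K : Type*} [Add G] [TwoUniqueSums G]
    [AddCommMonoid M] [AddCommMonoid N] [AddCommMonoid K] (f : G →₀ M) (g : G →₀ N)
    (c : G → M → G → N → K) (hc : ∀ i a j b, a ≠ 0 → b ≠ 0 → c i a j b ≠ 0) {k : G} {u : K}
    (hu : u ≠ 0)
    (h : (f.sum fun i a => g.sum fun j b => Finsupp.single (i + j) (c i a j b)) =
      Finsupp.single k u) :
    ∃ i a j b, f = Finsupp.single i a ∧ g = Finsupp.single j b ∧ i + j = k ∧ c i a j b = u := by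
  classical
  have key : ∀ i ∈ f.support, ∀ j ∈ g.support, UniqueAdd f.support g.support i j →
      (f.sum fun i a => g.sum fun j b => Finsupp.single (i + j) (c i a j b)) (i + j) =
        c i (f i) j (g j) := by
    intro i hi j hj huniq
    simp only [Finsupp.sum, Finsupp.finsetSum_apply]
    rw [Finset.sum_eq_single i, Finset.sum_eq_single j]
    · simp
    · intro j' hj' hne
      exact Finsupp.single_eq_of_ne fun he => hne (huniq hi hj' he.symm).2
    · exact fun hn => absurd hj hn
    · intro i' hi' hne
      exact Finset.sum_eq_zero fun j' hj' =>
        Finsupp.single_eq_of_ne fun he => hne (huniq hi' hj' he.symm).1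
    · exact fun hn => absurd hi hn
  have hk : ∀ i ∈ f.support, ∀ j ∈ g.support, UniqueAdd f.support g.support i j →
      i + j = k ∧ c i (f i) j (g j) = u := by
    intro i hi j hj huniq
    have h1 := key i hi j hj huniq
    have hne := hc i _ j _ (Finsupp.mem_support_iff.1 hi) (Finsupp.mem_support_iff.1 hj)
    rw [h] at h1
    have hkk : i + j = k := by
      by_contra hcon
      rw [Finsupp.single_eq_of_ne hcon] at h1
      exact hne h1.symm
    rw [hkk, Finsupp.single_eq_same] at h1
    exact ⟨hkk, h1.symm⟩
  have hf : f ≠ 0 := by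
    rintro rfl
    rw [Finsupp.sum_zero_index] at h
    exact hu (Finsupp.single_eq_zero.1 h.symm)
  have hg : g ≠ 0 := by
    rintro rfl
    simp only [Finsupp.sum_zero_index, Finsupp.sum_fun_zero] at h
    exact hu (Finsupp.single_eq_zero.1 h.symm)
  have hfc : 0 < f.support.card := Finset.card_pos.2 (Finsupp.support_nonempty_iff.2 hf)
  have hgc : 0 < g.support.card := Finset.card_pos.2 (Finsupp.support_nonempty_iff.2 hg)
  have hcard : f.support.card * g.support.card = 1 := by
    by_contra hcon
    have hlt : 1 < f.support.card * g.support.card := by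
      have := Nat.mul_pos hfc hgc
      omega
    obtain ⟨p, hp, r, hr, hne, hpu, hru⟩ := TwoUniqueSums.uniqueAdd_of_one_lt_card hlt
    rw [Finset.mem_product] at hp hr
    have h1 := (hk _ hp.1 _ hp.2 hpu).1
    have h2 := (hk _ hr.1 _ hr.2 hru).1
    have h3 := hpu hr.1 hr.2 (h2.trans h1.symm)
    exact hne (Prod.ext h3.1.symm h3.2.symm)
  obtain ⟨i, a, ha, rfl⟩ := Finsupp.card_support_eq_one'.1 (Nat.eq_one_of_mul_eq_one_right hcard)
  obtain ⟨j, b, hb, rfl⟩ := Finsupp.card_support_eq_one'.1 (Nat.eq_one_of_mul_eq_one_left hcard)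
  have huniq : UniqueAdd (Finsupp.single i a).support (Finsupp.single j b).support i j := by
    intro i' j' hi' hj' _
    exact ⟨Finset.mem_singleton.1 (Finsupp.support_single_subset hi'),
      Finset.mem_singleton.1 (Finsupp.support_single_subset hj')⟩
  have := hk i (by simp [ha]) j (by simp [hb]) huniq
  simp only [Finsupp.single_eq_same] at this
  exact ⟨i, a, j, b, rfl, rfl, this⟩

/-- The coordinate ring `ℂ[y, z, z⁻¹]`. -/
abbrev Coord : Type := AddMonoidAlgebra ℂ (ℕ × ℤ)

namespace Coord

open AddMonoidAlgebra

theorem eq_single_of_isUnit {r : Coord} (hr : IsUnit r) :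
    ∃ (n : ℤ) (c : ℂ), c ≠ 0 ∧ r = single (0, n) c := by
  obtain ⟨s, hs⟩ := hr.exists_right_inv
  have h : (r.coeff.sum fun i a => s.coeff.sum fun j b => Finsupp.single (i + j) (a * b)) =
      Finsupp.single 0 (1 : ℂ) := by
    have h' := congrArg coeff hs
    rw [AddMonoidAlgebra.mul_def] at h'
    simpa [Finsupp.sum, AddMonoidAlgebra.one_def] using h'
  obtain ⟨i, a, j, b, hri, -, hij, hab⟩ := eq_single_of_twisted_mul_eq_single r.coeff s.coeff
    (fun _ a _ b => a * b) (fun _ _ _ _ ha hb => mul_ne_zero ha hb) one_ne_zero h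
  have hi : i.1 = 0 := by
    have := congrArg Prod.fst hij
    simp only [Prod.fst_add, Prod.fst_zero] at this
    omega
  refine ⟨i.2, a, left_ne_zero_of_mul_eq_one hab, ?_⟩
  apply coeff_injective
  rw [hri, coeff_single, ← hi]

/-- The automorphism `y ↦ κ y`, `z ↦ z`. -/
noncomputable def scale (κ : ℂ) : Coord →ₐ[ℂ] Coord :=
  lift ℂ Coord (ℕ × ℤ)
    { toFun := fun g => single g.toAdd (κ ^ g.toAdd.1)
      map_one' := by simp [AddMonoidAlgebra.one_def]
      map_mul' := fun g h => by simp [AddMonoidAlgebra.single_mul_single, pow_add] }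

@[simp]
theorem scale_single (κ : ℂ) (g : ℕ × ℤ) (c : ℂ) :
    scale κ (single g c) = single g (c * κ ^ g.1) := by
  simp [scale]

theorem scale_scale (κ μ : ℂ) (r : Coord) : scale κ (scale μ r) = scale (κ * μ) r := by
  induction r using AddMonoidAlgebra.induction_linear with
  | zero => simp
  | add f g hf hg => simp [hf, hg]
  | single g c => simp [mul_pow, mul_left_comm, mul_comm]

theorem scale_one (r : Coord) : scale 1 r = r := by
  induction r using AddMonoidAlgebra.induction_linear with
  | zero => simp
  | add f g hf hg => simp [hf, hg]
  | single g c => simp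

theorem scale_inv_scale {κ : ℂ} (hκ : κ ≠ 0) (r : Coord) : scale κ⁻¹ (scale κ r) = r := by
  rw [scale_scale, inv_mul_cancel₀ hκ, scale_one]

theorem scale_ne_zero {κ : ℂ} (hκ : κ ≠ 0) {r : Coord} (hr : r ≠ 0) : scale κ r ≠ 0 := by
  intro h
  rw [← scale_inv_scale hκ r, h, map_zero] at hr
  exact hr rfl

theorem isUnit_of_isUnit_scale {κ : ℂ} (hκ : κ ≠ 0) {r : Coord} (hr : IsUnit (scale κ r)) :
    IsUnit r := by
  rw [← scale_inv_scale hκ r]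
  exact hr.map _

/-- Evaluation of `ℂ[y, z, z⁻¹]` at an element `y` and a unit `z` commuting with it. -/
noncomputable def eval {A : Type*} [Ring A] [Algebra ℂ A] (y : A) (z : Aˣ)
    (h : Commute y (z : A)) : Coord →ₐ[ℂ] A :=
  lift ℂ A (ℕ × ℤ)
    { toFun := fun g => y ^ g.toAdd.1 * ((z ^ g.toAdd.2 : Aˣ) : A)
      map_one' := by simp
      map_mul' := fun g h' => by
        have hc : Commute (y ^ h'.toAdd.1) ((z ^ g.toAdd.2 : Aˣ) : A) :=
          (h.units_zpow_right _).pow_left _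
        simp only [toAdd_mul, Prod.fst_add, Prod.snd_add, pow_add, zpow_add, Units.val_mul]
        rw [mul_assoc, mul_assoc, ← mul_assoc (y ^ h'.toAdd.1), hc.eq, mul_assoc] }

@[simp]
theorem eval_single {A : Type*} [Ring A] [Algebra ℂ A] (y : A) (z : Aˣ)
    (h : Commute y (z : A)) (g : ℕ × ℤ) (c : ℂ) :
    eval y z h (single g c) = c • (y ^ g.1 * ((z ^ g.2 : Aˣ) : A)) := by
  simp [eval]

/-- The polynomial `x x*` in `y` and `z`. -/
noncomputable def xxs (q : ℝ) (l : ℕ) : Coord :=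
  ((List.range l).map (fun p => 1 - ((q : ℂ) ^ (2 * p)) • (single (2, 1) (1 : ℂ) : Coord))).prod

/-- The polynomial `x* x` in `y` and `z`. -/
noncomputable def xsx (q : ℝ) (l : ℕ) : Coord :=
  ((List.range l).map
    (fun p => 1 - (((q : ℂ)⁻¹) ^ (2 * (p + 1))) • (single (2, 1) (1 : ℂ) : Coord))).prod

theorem scale_inv_xxs {q : ℝ} (hq : q ≠ 0) (l : ℕ) :
    scale ((q : ℂ) ^ l)⁻¹ (xxs q l) = xsx q l := by
  have hq' : (q : ℂ) ≠ 0 := by exact_mod_cast hq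
  have hr : ∀ f : ℕ → Coord, ((List.range l).map f).prod = ∏ p ∈ Finset.range l, f p := fun f => by
    rw [← List.prod_toFinset f (List.nodup_range), List.toFinset_range]
  rw [xxs, xsx, map_list_prod, List.map_map, hr, hr, ← Finset.prod_range_reflect]
  refine Finset.prod_congr rfl fun p hp => ?_
  rw [Finset.mem_range] at hp
  obtain ⟨k, rfl⟩ : ∃ k, l = p + 1 + k := ⟨l - (p + 1), by omega⟩
  have hk : p + 1 + k - 1 - p = k := by omega
  simp only [Function.comp_apply, hk, map_sub, map_one, map_smul, scale_single, one_mul]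
  congr 1
  simp only [AddMonoidAlgebra.smul_single]
  congr 1
  simp only [smul_eq_mul, mul_one]
  rw [inv_pow, inv_pow, ← pow_mul]
  field_simp
  ring

theorem not_isUnit_xxs (q : ℝ) {l : ℕ} (hl : 0 < l) : ¬ IsUnit (xxs q l) := by
  intro h
  have h0 : eval (1 : ℂ) 1 (Commute.all _ _) (xxs q l) = 0 := by
    rw [xxs, map_list_prod, List.map_map]
    apply List.prod_eq_zero
    exact List.mem_map.2 ⟨0, List.mem_range.2 hl, by simp⟩
  have := h.map (eval (1 : ℂ) 1 (Commute.all _ _))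
  rw [h0] at this
  exact not_isUnit_zero this

theorem xxs_ne_zero (q : ℝ) (l : ℕ) : xxs q l ≠ 0 := by
  intro h
  have h0 : eval (0 : ℂ) 1 (Commute.all _ _) (xxs q l) = 1 := by
    rw [xxs, map_list_prod, List.map_map]
    apply List.prod_eq_one
    intro a ha
    obtain ⟨p, -, rfl⟩ := List.mem_map.1 ha
    simp
  rw [h, map_zero] at h0
  exact zero_ne_one h0

end Coord

/-- The double `E × Eᵐᵒᵖ` of a complex algebra, with scalars acting conjugated on the second
factor. Exchanging the factors makes it a *-algebra. -/
def Double (E : Type) : Type := E × Eᵐᵒᵖ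

namespace Double

open MulOpposite

variable {E : Type}

/-- The element `(a, b)` of the double. -/
def mk (a b : E) : Double E := (a, op b)

@[ext]
theorem ext {u v : Double E} (h₁ : u.1 = v.1) (h₂ : unop u.2 = unop v.2) : u = v :=
  Prod.ext h₁ (unop_injective h₂)

@[simp] theorem mk_fst (a b : E) : (mk a b).1 = a := rfl
@[simp] theorem mk_snd (a b : E) : unop (mk a b).2 = b := rfl
variable [Ring E]

instance : Ring (Double E) := inferInstanceAs (Ring (E × Eᵐᵒᵖ))

@[simp] theorem mul_fst (u v : Double E) : (u * v).1 = u.1 * v.1 := rfl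
@[simp] theorem mul_snd (u v : Double E) : unop (u * v).2 = unop v.2 * unop u.2 := rfl
@[simp] theorem one_fst : (1 : Double E).1 = 1 := rfl
@[simp] theorem one_snd : unop (1 : Double E).2 = 1 := rfl

instance : StarRing (Double E) where
  star u := mk (unop u.2) u.1
  star_involutive _ := rfl
  star_mul _ _ := rfl
  star_add _ _ := rfl

@[simp] theorem star_fst (u : Double E) : (star u).1 = unop u.2 := rfl
@[simp] theorem star_snd (u : Double E) : unop (star u).2 = u.1 := rfl

theorem eq_of_isSelfAdjoint {u v : Double E} (hu : IsSelfAdjoint u) (hv : IsSelfAdjoint v)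
    (h : u.1 = v.1) : u = v := by
  refine Double.ext h ?_
  rw [← star_fst, ← star_fst, hu.star_eq, hv.star_eq, h]

variable [Algebra ℂ E]

instance : Algebra ℂ (Double E) :=
  RingHom.toAlgebra' (R := ℂ) (S := Double E)
    ((algebraMap ℂ E).prod (((algebraMap ℂ Eᵐᵒᵖ).comp (starRingEnd ℂ))))
    fun c u => Prod.ext (Algebra.commutes c u.1) (Algebra.commutes (starRingEnd ℂ c) u.2)

@[simp]
theorem smul_fst (c : ℂ) (u : Double E) : (c • u).1 = c • u.1 := (Algebra.smul_def c u.1).symm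

@[simp]
theorem smul_snd (c : ℂ) (u : Double E) : unop (c • u).2 = (starRingEnd ℂ c) • unop u.2 := by
  rw [← unop_smul]
  exact congrArg unop (Algebra.smul_def (starRingEnd ℂ c) u.2).symm

instance : StarModule ℂ (Double E) where
  star_smul c u := by
    ext <;> simp

/-- The first projection of the double. -/
def fstHom : Double E →ₐ[ℂ] E :=
  { RingHom.fst E Eᵐᵒᵖ with
    commutes' := fun _ => rfl }

@[simp] theorem fstHom_apply (u : Double E) : fstHom u = u.1 := rfl

end Double

theorem isSelfAdjoint_prod_range {B : Type*} [Ring B] [Algebra ℂ B] [StarRing B] [StarModule ℂ B]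
    {w : B} (hw : IsSelfAdjoint w) (c : ℕ → ℂ) (hc : ∀ p, IsSelfAdjoint (c p)) (l : ℕ) :
    IsSelfAdjoint (((List.range l).map (fun p => 1 - c p • w)).prod) := by
  induction l with
  | zero => simp
  | succ n ih =>
    rw [List.range_succ, List.map_append, List.prod_append, List.map_singleton,
      List.prod_singleton]
    have h1 : IsSelfAdjoint (1 - c n • w) := (IsSelfAdjoint.one B).sub ((hc n).smul hw)
    rw [← IsSelfAdjoint.commute_iff ih h1]
    refine Commute.list_prod_left _ _ fun a ha => ?_
    obtain ⟨p, -, rfl⟩ := List.mem_map.1 ha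
    exact (Commute.one_left _).sub_left
      (((Commute.one_right _).sub_right ((Commute.refl w).smul_right _)).smul_left _)

open MulOpposite in
/-- The universal property of the underlying algebra, in which `x*` and `z*` are generators. -/
theorem exists_algHom {q : ℝ} {l : ℕ} (Pm : SMinusAlg q l) {E : Type} [Ring E] [Algebra ℂ E]
    (X X' Y Z Z' : E) (hZX : Z * X = X * Z) (hZX' : Z * X' = X' * Z) (hZY : Z * Y = Y * Z)
    (hZZ' : Z * Z' = 1) (hZ'Z : Z' * Z = 1)
    (hXY : X * Y = ((q : ℂ) ^ l) • (Y * X)) (hYX' : Y * X' = ((q : ℂ) ^ l) • (X' * Y))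
    (hXX' : X * X' = ((List.range l).map (fun p => 1 - ((q : ℂ) ^ (2 * p)) • (Y ^ 2 * Z))).prod)
    (hX'X : X' * X = ((List.range l).map
      (fun p => 1 - (((q : ℂ)⁻¹) ^ (2 * (p + 1))) • (Y ^ 2 * Z))).prod) :
    ∃ f : Pm.A →ₐ[ℂ] E, f Pm.x = X ∧ f (star Pm.x) = X' ∧ f Pm.y = Y ∧ f Pm.z = Z := by
  have hcomm : ∀ {T : E}, Z * T = T * Z → Z' * T = T * Z' := fun {T} hT => by
    calc Z' * T = Z' * (T * Z) * Z' := by rw [mul_assoc, mul_assoc, hZZ', mul_one]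
      _ = T * Z' := by rw [← hT, ← mul_assoc, hZ'Z, one_mul]
  have hZ'Y := hcomm hZY
  have hY : Z' * (Y * Z) = Y := by rw [← mul_assoc, hZ'Y, mul_assoc, hZ'Z, mul_one]
  have hYT : ∀ T, Z' * (Y * (Z * T)) = Y * T := fun T => by
    rw [← mul_assoc Y, ← mul_assoc, hY]
  have hw : IsSelfAdjoint (Double.mk Y (Y * Z) ^ 2 * Double.mk Z Z') := by
    rw [isSelfAdjoint_iff]
    ext <;> simp [pow_two, hYT, mul_assoc]
  have hsa : ∀ (c : ℕ → ℂ), (∀ p, IsSelfAdjoint (c p)) → ∀ (U : Double E), IsSelfAdjoint U →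
      U.1 = ((List.range l).map (fun p => 1 - c p • (Y ^ 2 * Z))).prod →
      U = ((List.range l).map
        (fun p => 1 - c p • (Double.mk Y (Y * Z) ^ 2 * Double.mk Z Z'))).prod := by
    intro c hc U hU h
    refine Double.eq_of_isSelfAdjoint hU (isSelfAdjoint_prod_range hw c hc l) ?_
    rw [h, ← Double.fstHom_apply, map_list_prod, List.map_map]
    congr 1
    refine List.map_congr_left fun p _ => ?_
    simp only [Function.comp_apply, map_sub, map_one, map_smul, map_mul, map_pow,
      Double.fstHom_apply, Double.mk_fst]
  have hq : IsSelfAdjoint (q : ℂ) := Complex.conj_ofReal q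
  obtain ⟨f, ⟨hfx, hfy, hfz⟩, -⟩ := Pm.universal (Double E) (Double.mk X X')
    (Double.mk Y (Y * Z)) (Double.mk Z Z')
    { central_x := by ext <;> simp [hZX, hcomm hZX']
      central_y := by
        ext
        · simp [hZY]
        · simp [mul_assoc, hZZ', hY]
      central_xs := by ext <;> simp [hZX', hcomm hZX]
      central_ys := by
        ext
        · simp [← mul_assoc, hZY]
        · simp [hZ'Y]
      unitary := by ext <;> simp [hZZ']
      unitary' := by ext <;> simp [hZ'Z]
      rel_ystar := by
        ext
        · simp
        · simp [hY]
      rel_xy := by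
        ext
        · simp [hXY]
        · simp [mul_assoc, hZX']
          simp [← mul_assoc, hYX']
      rel_xxs := hsa _ (fun p => hq.pow _) _ (IsSelfAdjoint.mul_star_self _) (by simp [hXX'])
      rel_xsx := hsa _ (fun p => hq.inv₀.pow _) _ (IsSelfAdjoint.star_mul_self _)
        (by simp [hX'X]) }
  refine ⟨Double.fstHom.comp f.toAlgHom, ?_, ?_, ?_, ?_⟩
  · simp [hfx]
  · simp [hfx, map_star]
  · simp [hfy]
  · simp [hfz]

theorem mul_eval {A : Type*} [Ring A] [Algebra ℂ A] {y t : A} {z : Aˣ} (h : Commute y (z : A))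
    {κ : ℂ} (hy : t * y = κ • (y * t)) (hz : Commute t (z : A)) (r : Coord) :
    t * Coord.eval y z h r = Coord.eval y z h (Coord.scale κ r) * t := by
  induction r using AddMonoidAlgebra.induction_linear with
  | zero => simp
  | add f g hf hg => simp [mul_add, add_mul, hf, hg]
  | single g c =>
    have h1 : SemiconjBy t y (κ • y) := by rw [SemiconjBy, hy, smul_mul_assoc]
    have h2 : t * (y ^ g.1 * ((z ^ g.2 : Aˣ) : A)) = _ :=
      (h1.pow_right g.1).mul_right (hz.units_zpow_right g.2)
    rw [Coord.scale_single, Coord.eval_single, Coord.eval_single, mul_smul_comm, h2, smul_pow,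
      smul_mul_assoc, smul_mul_assoc, smul_smul, smul_mul_assoc]

/-- The power `xⁿ`, where `x'` plays the role of the inverse of `x`. -/
def xpow {A : Type*} [Monoid A] (x x' : A) : ℤ → A
  | Int.ofNat n => x ^ n
  | Int.negSucc n => x' ^ (n + 1)

section Relations

variable {A : Type} [Ring A] [Algebra ℂ A] [StarRing A] [StarModule ℂ A] {q : ℝ} {l : ℕ}
  {x y z : A}

/-- The generator `z` as a unit. -/
def zUnit (h : SMinusRels q l x y z) : Aˣ := ⟨z, star z, h.unitary, h.unitary'⟩

theorem commute_zUnit (h : SMinusRels q l x y z) : Commute y (zUnit h : A) := h.central_y.symm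

/-- The homomorphism from the coordinate ring given by `y` and `z`. -/
noncomputable def coordHom (h : SMinusRels q l x y z) : Coord →ₐ[ℂ] A :=
  Coord.eval y (zUnit h) (commute_zUnit h)

theorem star_x_mul_y (hq : q ≠ 0) (h : SMinusRels q l x y z) :
    star x * y = ((q : ℂ) ^ l)⁻¹ • (y * star x) := by
  have hκ : ((q : ℂ) ^ l) ≠ 0 := pow_ne_zero _ (by exact_mod_cast hq)
  have h1 := congrArg star h.rel_xy
  rw [star_smul, star_mul, star_mul, h.rel_ystar, star_pow, Complex.star_def, Complex.conj_ofReal,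
    mul_assoc, h.central_xs, ← mul_assoc, ← mul_assoc, ← smul_mul_assoc] at h1
  have h2 := congrArg (· * star z) h1
  simp only [mul_assoc, smul_mul_assoc, h.unitary, mul_one] at h2
  rw [h2, inv_smul_smul₀ hκ]

theorem x_mul_coordHom (h : SMinusRels q l x y z) (r : Coord) :
    x * coordHom h r = coordHom h (Coord.scale ((q : ℂ) ^ l) r) * x :=
  mul_eval (commute_zUnit h) h.rel_xy h.central_x.symm r

theorem star_x_mul_coordHom (hq : q ≠ 0) (h : SMinusRels q l x y z) (r : Coord) :
    star x * coordHom h r = coordHom h (Coord.scale ((q : ℂ) ^ l)⁻¹ r) * star x :=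
  mul_eval (commute_zUnit h) (star_x_mul_y hq h) h.central_xs.symm r

theorem coordHom_single (h : SMinusRels q l x y z) (g : ℕ × ℤ) (c : ℂ) :
    coordHom h (AddMonoidAlgebra.single g c) = c • (y ^ g.1 * ((zUnit h ^ g.2 : Aˣ) : A)) :=
  Coord.eval_single _ _ _ _ _

theorem coordHom_y (h : SMinusRels q l x y z) :
    coordHom h (AddMonoidAlgebra.single (1, 0) 1) = y := by
  simp [coordHom_single]

theorem coordHom_z (h : SMinusRels q l x y z) :
    coordHom h (AddMonoidAlgebra.single (0, 1) 1) = z := by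
  simp [coordHom_single, zUnit]

theorem coordHom_star_z (h : SMinusRels q l x y z) :
    coordHom h (AddMonoidAlgebra.single (0, -1) 1) = star z := by
  simp [coordHom_single, zUnit]

theorem coordHom_xxs (h : SMinusRels q l x y z) : coordHom h (Coord.xxs q l) = x * star x := by
  rw [h.rel_xxs, Coord.xxs, map_list_prod, List.map_map]
  congr 1
  refine List.map_congr_left fun p _ => ?_
  simp [coordHom_single, zUnit]

theorem coordHom_xsx (h : SMinusRels q l x y z) : coordHom h (Coord.xsx q l) = star x * x := by
  rw [h.rel_xsx, Coord.xsx, map_list_prod, List.map_map]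
  congr 1
  refine List.map_congr_left fun p _ => ?_
  simp [coordHom_single, zUnit]

theorem x_mul_xpow (h : SMinusRels q l x y z) (n : ℤ) :
    ∃ r m, x * xpow x (star x) n = coordHom h r * xpow x (star x) m := by
  rcases n with n | n
  · exact ⟨1, Int.ofNat (n + 1), by simp [xpow, pow_succ']⟩
  · refine ⟨Coord.xxs q l, -n, ?_⟩
    rw [coordHom_xxs]
    rcases n with _ | n
    · simp [xpow]
    · change x * star x ^ (n + 1 + 1) = x * star x * star x ^ (n + 1)
      rw [pow_succ', mul_assoc]

theorem star_x_mul_xpow (h : SMinusRels q l x y z) (n : ℤ) :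
    ∃ r m, star x * xpow x (star x) n = coordHom h r * xpow x (star x) m := by
  rcases n with (_ | n) | n
  · exact ⟨1, Int.negSucc 0, by simp [xpow]⟩
  · refine ⟨Coord.xsx q l, Int.ofNat n, ?_⟩
    rw [coordHom_xsx]
    simp [xpow, pow_succ', mul_assoc]
  · exact ⟨1, Int.negSucc (n + 1), by simp [xpow, pow_succ' _ (n + 1)]⟩

/-- The element `∑ rₙ xⁿ` with coefficients `rₙ` in the coordinate ring. -/
noncomputable def normalForm (h : SMinusRels q l x y z) : (ℤ →₀ Coord) →ₗ[ℂ] A :=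
  Finsupp.lsum ℂ fun n =>
    (LinearMap.mulRight ℂ (xpow x (star x) n)) ∘ₗ (coordHom h).toLinearMap

theorem normalForm_single (h : SMinusRels q l x y z) (n : ℤ) (r : Coord) :
    normalForm h (Finsupp.single n r) = coordHom h r * xpow x (star x) n := by
  simp [normalForm]

theorem mul_mem_range_normalForm (h : SMinusRels q l x y z) {t : A}
    (ht : ∀ r n, ∃ s m, t * (coordHom h r * xpow x (star x) n) =
      coordHom h s * xpow x (star x) m) {a : A} (ha : a ∈ LinearMap.range (normalForm h)) :
    t * a ∈ LinearMap.range (normalForm h) := by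
  obtain ⟨v, rfl⟩ := ha
  induction v using Finsupp.induction_linear with
  | zero => simp
  | add f g hf hg =>
    rw [map_add, mul_add]
    exact add_mem hf hg
  | single n r =>
    obtain ⟨s, m, hs⟩ := ht r n
    exact ⟨Finsupp.single m s, by rw [normalForm_single, normalForm_single, hs]⟩

theorem x_mul_mem (h : SMinusRels q l x y z) {a : A} (ha : a ∈ LinearMap.range (normalForm h)) :
    x * a ∈ LinearMap.range (normalForm h) := by
  refine mul_mem_range_normalForm h (fun r n => ?_) ha
  obtain ⟨s, m, hs⟩ := x_mul_xpow h n
  exact ⟨_, m, by rw [← mul_assoc, x_mul_coordHom, mul_assoc, hs, ← mul_assoc, ← map_mul]⟩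

theorem star_x_mul_mem (hq : q ≠ 0) (h : SMinusRels q l x y z) {a : A}
    (ha : a ∈ LinearMap.range (normalForm h)) :
    star x * a ∈ LinearMap.range (normalForm h) := by
  refine mul_mem_range_normalForm h (fun r n => ?_) ha
  obtain ⟨s, m, hs⟩ := star_x_mul_xpow h n
  exact ⟨_, m, by rw [← mul_assoc, star_x_mul_coordHom hq, mul_assoc, hs, ← mul_assoc, ← map_mul]⟩

theorem coordHom_mul_mem (h : SMinusRels q l x y z) (r : Coord) {a : A}
    (ha : a ∈ LinearMap.range (normalForm h)) :
    coordHom h r * a ∈ LinearMap.range (normalForm h) :=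
  mul_mem_range_normalForm h (fun s n => ⟨r * s, n, by rw [← mul_assoc, ← map_mul]⟩) ha

end Relations

theorem mem_starSubalgebra {q : ℝ} {l : ℕ} (Pm : SMinusAlg q l) (S : StarSubalgebra ℂ Pm.A)
    (hx : Pm.x ∈ S) (hy : Pm.y ∈ S) (hz : Pm.z ∈ S) (a : Pm.A) : a ∈ S := by
  have hprod : ∀ c : ℕ → ℂ, S.subtype ((List.range l).map
      (fun p => 1 - c p • ((⟨Pm.y, hy⟩ : S) ^ 2 * ⟨Pm.z, hz⟩))).prod =
      ((List.range l).map (fun p => 1 - c p • (Pm.y ^ 2 * Pm.z))).prod := fun c => by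
    rw [map_list_prod, List.map_map]
    rfl
  have hS : SMinusRels q l (⟨Pm.x, hx⟩ : S) ⟨Pm.y, hy⟩ ⟨Pm.z, hz⟩ :=
    { central_x := Subtype.ext Pm.rels.central_x
      central_y := Subtype.ext Pm.rels.central_y
      central_xs := Subtype.ext Pm.rels.central_xs
      central_ys := Subtype.ext Pm.rels.central_ys
      unitary := Subtype.ext Pm.rels.unitary
      unitary' := Subtype.ext Pm.rels.unitary'
      rel_ystar := Subtype.ext Pm.rels.rel_ystar
      rel_xy := Subtype.ext Pm.rels.rel_xy
      rel_xxs := Subtype.ext (Pm.rels.rel_xxs.trans (hprod _).symm)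
      rel_xsx := Subtype.ext (Pm.rels.rel_xsx.trans (hprod _).symm) }
  obtain ⟨f, ⟨hfx, hfy, hfz⟩, -⟩ := Pm.universal S _ _ _ hS
  have h1 : S.subtype.comp f = StarAlgHom.id ℂ Pm.A :=
    (Pm.universal Pm.A _ _ _ Pm.rels).unique (by simp [hfx, hfy, hfz]) (by simp)
  have h2 : ((f a : S) : Pm.A) = a := DFunLike.congr_fun h1 a
  rw [← h2]
  exact (f a).2

theorem normalForm_surjective {q : ℝ} (hq : q ≠ 0) {l : ℕ} (Pm : SMinusAlg q l) :
    Function.Surjective (normalForm Pm.rels) := by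
  intro a
  let M := LinearMap.range (normalForm Pm.rels)
  let S : StarSubalgebra ℂ Pm.A :=
    { carrier := {a | (∀ m ∈ M, a * m ∈ M) ∧ ∀ m ∈ M, star a * m ∈ M}
      mul_mem' := fun {a b} ha hb => ⟨fun m hm => by
          rw [mul_assoc]
          exact ha.1 _ (hb.1 _ hm), fun m hm => by
          rw [star_mul, mul_assoc]
          exact hb.2 _ (ha.2 _ hm)⟩
      add_mem' := fun {a b} ha hb => ⟨fun m hm => by
          rw [add_mul]
          exact add_mem (ha.1 _ hm) (hb.1 _ hm), fun m hm => by
          rw [star_add, add_mul]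
          exact add_mem (ha.2 _ hm) (hb.2 _ hm)⟩
      algebraMap_mem' := fun c => ⟨fun m hm => by
          rw [← Algebra.smul_def]
          exact M.smul_mem _ hm, fun m hm => by
          rw [← algebraMap_star_comm, ← Algebra.smul_def]
          exact M.smul_mem _ hm⟩
      star_mem' := fun {a} ha => ⟨ha.2, fun m hm => by
          rw [star_star]
          exact ha.1 _ hm⟩ }
  have hy : ∀ m ∈ M, Pm.y * m ∈ M := fun m hm => by
    rw [← coordHom_y Pm.rels]
    exact coordHom_mul_mem _ _ hm
  have hz : ∀ m ∈ M, Pm.z * m ∈ M := fun m hm => by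
    nth_rewrite 1 [← coordHom_z Pm.rels]
    exact coordHom_mul_mem _ _ hm
  have hzs : ∀ m ∈ M, star Pm.z * m ∈ M := fun m hm => by
    rw [← coordHom_star_z Pm.rels]
    exact coordHom_mul_mem _ _ hm
  have ha : a ∈ S := mem_starSubalgebra Pm S
    ⟨fun m hm => x_mul_mem _ hm, fun m hm => star_x_mul_mem hq _ hm⟩
    ⟨hy, fun m hm => by
      rw [Pm.rels.rel_ystar, mul_assoc]
      exact hy _ (hz _ hm)⟩ ⟨hz, hzs⟩ a
  have h1 : (1 : Pm.A) ∈ M :=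
    ⟨Finsupp.single 0 1, by
      simp [normalForm_single, show xpow Pm.x (star Pm.x) 0 = 1 from pow_zero _]⟩
  rw [← mul_one a]
  exact ha.1 1 h1

section Model

/-- The operator `single n r ↦ single (n + d) (scale κ r)`. -/
noncomputable def shift (κ : ℂ) (d : ℤ) : Module.End ℂ (ℤ →₀ Coord) :=
  Finsupp.lsum ℂ fun n => (Finsupp.lsingle (n + d)) ∘ₗ (Coord.scale κ).toLinearMap

@[simp]
theorem shift_single (κ : ℂ) (d n : ℤ) (r : Coord) :
    shift κ d (Finsupp.single n r) = Finsupp.single (n + d) (Coord.scale κ r) := by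
  simp [shift]

/-- Multiplication by elements of the coordinate ring. -/
noncomputable def mulOp : Coord →ₐ[ℂ] Module.End ℂ (ℤ →₀ Coord) :=
  Algebra.lsmul ℂ ℂ (ℤ →₀ Coord)

@[simp]
theorem mulOp_apply (r : Coord) (v : ℤ →₀ Coord) : mulOp r v = r • v := rfl

theorem shift_mul_mulOp (κ : ℂ) (d : ℤ) (r : Coord) :
    shift κ d * mulOp r = mulOp (Coord.scale κ r) * shift κ d := by
  refine Finsupp.lhom_ext fun n s => ?_
  simp only [Module.End.mul_apply, mulOp_apply, Finsupp.smul_single, shift_single, smul_eq_mul,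
    map_mul]

theorem shift_mul_shift {κ μ : ℂ} (h : κ * μ = 1) (d : ℤ) : shift κ d * shift μ (-d) = 1 := by
  refine Finsupp.lhom_ext fun n s => ?_
  simp [Coord.scale_scale, h, Coord.scale_one]

open AddMonoidAlgebra in
/-- The representation of `O(Σ_q³(l,−))` by twisted shifts. -/
theorem exists_rep {q : ℝ} (hq : q ≠ 0) {l : ℕ} (Pm : SMinusAlg q l) :
    ∃ f : Pm.A →ₐ[ℂ] Module.End ℂ (ℤ →₀ Coord), f Pm.x = shift ((q : ℂ) ^ l) 1 ∧
      f (star Pm.x) = shift ((q : ℂ) ^ l)⁻¹ (-1) * mulOp (Coord.xxs q l) ∧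
      ∀ r, f (coordHom Pm.rels r) = mulOp r := by
  have hκ : ((q : ℂ) ^ l) ≠ 0 := pow_ne_zero _ (by exact_mod_cast hq)
  set κ := (q : ℂ) ^ l with hκdef
  have hy : Coord.scale κ (single (1, 0) 1) = κ • single (1, 0) 1 := by simp
  have hy' : Coord.scale κ⁻¹ (single (1, 0) 1) = κ⁻¹ • single (1, 0) 1 := by simp
  have hz : ∀ μ, Coord.scale μ (single (0, 1) 1) = single (0, 1) 1 := fun μ => by simp
  have hw : (single (1, 0) 1 : Coord) ^ 2 * single (0, 1) 1 = single (2, 1) 1 := by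
    simp [AddMonoidAlgebra.single_pow, AddMonoidAlgebra.single_mul_single]
  have hzz' : (single (0, 1) 1 : Coord) * single (0, -1) 1 = 1 := by
    rw [AddMonoidAlgebra.single_mul_single, one_mul]
    rfl
  have hprod : ∀ c : ℕ → ℂ, mulOp (((List.range l).map
      (fun p => 1 - c p • (single (2, 1) (1 : ℂ) : Coord))).prod) = ((List.range l).map
      (fun p => 1 - c p • (mulOp (single (1, 0) 1) ^ 2 * mulOp (single (0, 1) 1)))).prod :=
    fun c => by
      rw [map_list_prod, List.map_map, ← map_pow, ← map_mul, hw]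
      congr 1
      refine List.map_congr_left fun p _ => ?_
      rw [Function.comp_apply, map_sub, map_one, map_smul]
  obtain ⟨f, hfx, hfx', hfy, hfz⟩ := exists_algHom Pm (shift κ 1)
    (shift κ⁻¹ (-1) * mulOp (Coord.xxs q l)) (mulOp (single (1, 0) 1)) (mulOp (single (0, 1) 1))
    (mulOp (single (0, -1) 1))
    (by rw [shift_mul_mulOp, hz])
    (by rw [mul_assoc, ← map_mul, mul_comm (Coord.xxs q l), map_mul, ← mul_assoc, ← mul_assoc,
      shift_mul_mulOp, hz])
    (by rw [← map_mul, ← map_mul, mul_comm])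
    (by rw [← map_mul, hzz', map_one])
    (by rw [← map_mul, mul_comm, hzz', map_one])
    (by rw [shift_mul_mulOp, hy, map_smul, smul_mul_assoc])
    (by rw [mul_assoc (shift _ _), ← map_mul, mul_comm (Coord.xxs q l), map_mul,
      ← mul_assoc (shift _ _), shift_mul_mulOp κ⁻¹ _ (single _ _), hy', map_smul,
      smul_mul_assoc, smul_mul_assoc, smul_inv_smul₀ hκ, mul_assoc])
    (by rw [← mul_assoc, shift_mul_shift (mul_inv_cancel₀ hκ), one_mul, Coord.xxs, hprod])
    (by
      have h1 := shift_mul_shift (inv_mul_cancel₀ hκ) (-1)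
      rw [neg_neg] at h1
      rw [shift_mul_mulOp, hκdef, Coord.scale_inv_xxs hq, mul_assoc, ← hκdef, h1, mul_one,
        Coord.xsx, hprod])
  refine ⟨f, hfx, hfx', fun r => ?_⟩
  let w : Coordˣ := ⟨single (0, 1) 1, single (0, -1) 1,
    hzz', by rw [mul_comm, hzz']⟩
  have hwU : Units.map (MonoidHomClass.toMonoidHom f) (zUnit Pm.rels) =
      Units.map (MonoidHomClass.toMonoidHom mulOp) w :=
    Units.ext hfz
  have hwpow : ∀ n : ℤ, ((w ^ n : Coordˣ) : Coord) = single (0, n) 1 := by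
    have hnat : ∀ n : ℕ, (w : Coord) ^ n = single (0, (n : ℤ)) 1 := fun n => by
      simp [w, AddMonoidAlgebra.single_pow]
    have hnat' : ∀ n : ℕ, ((w⁻¹ : Coordˣ) : Coord) ^ n = single (0, -(n : ℤ)) 1 := fun n => by
      simp [w, AddMonoidAlgebra.single_pow]
    intro n
    obtain ⟨n, rfl | rfl⟩ := n.eq_nat_or_neg
    · rw [zpow_natCast, Units.val_pow_eq_pow_val, hnat]
    · rw [zpow_neg, zpow_natCast, ← inv_pow, Units.val_pow_eq_pow_val, hnat']
  induction r using AddMonoidAlgebra.induction_linear with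
  | zero => rw [map_zero, map_zero, map_zero]
  | add r s hr hs => rw [map_add, map_add, map_add, hr, hs]
  | single g c =>
    have hg : (single g c : Coord) = c • (single (1, 0) 1 ^ g.1 * ((w ^ g.2 : Coordˣ) : Coord)) := by
      rw [hwpow]
      simp [AddMonoidAlgebra.single_pow, AddMonoidAlgebra.single_mul_single]
    have hz2 : f ((zUnit Pm.rels ^ g.2 : (Pm.A)ˣ) : Pm.A) =
        mulOp ((w ^ g.2 : Coordˣ) : Coord) := by
      have h1 := congrArg (fun u : (Module.End ℂ (ℤ →₀ Coord))ˣ => (u ^ g.2).val) hwU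
      simp only [← map_zpow] at h1
      exact h1
    rw [coordHom_single, map_smul, map_mul, map_pow, hfy, hz2, hg, map_smul, map_mul, map_pow]

/-- The powers of `x` and `x*` act by shifts followed by multiplication by nonzero elements,
which are not invertible for powers of `x*`. -/
theorem exists_rep_xpow {q : ℝ} (hq : q ≠ 0) {l : ℕ} (hl : 0 < l) (Pm : SMinusAlg q l)
    (f : Pm.A →ₐ[ℂ] Module.End ℂ (ℤ →₀ Coord)) (hfx : f Pm.x = shift ((q : ℂ) ^ l) 1)
    (hfx' : f (star Pm.x) = shift ((q : ℂ) ^ l)⁻¹ (-1) * mulOp (Coord.xxs q l)) (n : ℤ) :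
    ∃ p : Coord, p ≠ 0 ∧ (n < 0 → ¬ IsUnit p) ∧ ∀ m r,
      f (xpow Pm.x (star Pm.x) n) (Finsupp.single m r) =
        Finsupp.single (n + m) (p * Coord.scale (((q : ℂ) ^ l) ^ n) r) := by
  have hκ : ((q : ℂ) ^ l) ≠ 0 := pow_ne_zero _ (by exact_mod_cast hq)
  set κ := (q : ℂ) ^ l with hκdef
  rcases n with n | n
  · refine ⟨1, one_ne_zero, fun h => absurd h (by simp), fun m r => ?_⟩
    change f (Pm.x ^ n) _ = _
    induction n with
    | zero => simp [Coord.scale_one]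
    | succ n ih =>
      rw [pow_succ', map_mul, Module.End.mul_apply, ih, hfx, shift_single]
      simp only [one_mul, Coord.scale_scale, Int.ofNat_eq_natCast, zpow_natCast, pow_succ']
      congr 1
      push_cast
      ring
  · change ∃ p : Coord, p ≠ 0 ∧ (_ → ¬ IsUnit p) ∧ ∀ m r,
      f (star Pm.x ^ (n + 1)) (Finsupp.single m r) = _
    have hstep : ∀ m r, f (star Pm.x) (Finsupp.single m r) =
        Finsupp.single (m + -1) (Coord.scale κ⁻¹ (Coord.xxs q l * r)) := fun m r => by
      rw [hfx', Module.End.mul_apply, mulOp_apply, Finsupp.smul_single, shift_single, smul_eq_mul]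
    induction n with
    | zero =>
      refine ⟨Coord.scale κ⁻¹ (Coord.xxs q l), Coord.scale_ne_zero (inv_ne_zero hκ)
        (Coord.xxs_ne_zero q l), fun _ h => Coord.not_isUnit_xxs q hl
          (Coord.isUnit_of_isUnit_scale (inv_ne_zero hκ) h), fun m r => ?_⟩
      rw [zero_add, pow_one, hstep, map_mul, add_comm]
      simp
    | succ n ih =>
      obtain ⟨p, hp0, -, hp⟩ := ih
      refine ⟨Coord.scale κ⁻¹ (Coord.xxs q l * p), Coord.scale_ne_zero (inv_ne_zero hκ)
        (mul_ne_zero (Coord.xxs_ne_zero q l) hp0), fun _ h => Coord.not_isUnit_xxs q hl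
          (isUnit_of_mul_isUnit_left (Coord.isUnit_of_isUnit_scale (inv_ne_zero hκ) h)),
        fun m r => ?_⟩
      rw [pow_succ', map_mul, Module.End.mul_apply, hp, hstep, ← mul_assoc, map_mul,
        Coord.scale_scale]
      have h1 : κ⁻¹ * κ ^ Int.negSucc n = κ ^ Int.negSucc (n + 1) := by
        rw [zpow_negSucc, zpow_negSucc, pow_succ' _ (n + 1), mul_inv]
      rw [h1]
      congr 1
      rw [Int.negSucc_eq, Int.negSucc_eq]
      push_cast
      ring

end Model

theorem exists_coordHom_of_isUnit {q : ℝ} (hq : q ≠ 0) {l : ℕ} (hl : 0 < l) (Pm : SMinusAlg q l)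
    {a : Pm.A} (ha : IsUnit a) : ∃ r : Coord, IsUnit r ∧ a = coordHom Pm.rels r := by
  have hκ : ((q : ℂ) ^ l) ≠ 0 := pow_ne_zero _ (by exact_mod_cast hq)
  obtain ⟨b, hab⟩ := ha.exists_right_inv
  obtain ⟨f, hfx, hfx', hfr⟩ := exists_rep hq Pm
  choose p hp0 hpu hp using exists_rep_xpow hq hl Pm f hfx hfx'
  obtain ⟨v, rfl⟩ := normalForm_surjective hq Pm a
  obtain ⟨w, rfl⟩ := normalForm_surjective hq Pm b
  have hact : ∀ (u : ℤ →₀ Coord) m s, f (normalForm Pm.rels u) (Finsupp.single m s) =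
      u.sum fun i r => Finsupp.single (i + m) (r * (p i * Coord.scale (((q : ℂ) ^ l) ^ i) s)) := by
    intro u m s
    induction u using Finsupp.induction_linear with
    | zero => simp
    | add u u' hu hu' =>
      rw [map_add, map_add, LinearMap.add_apply, hu, hu', Finsupp.sum_add_index']
      · simp
      · simp [add_mul]
    | single i r =>
      rw [normalForm_single, map_mul, Module.End.mul_apply, hp, hfr, mulOp_apply,
        Finsupp.smul_single, Finsupp.sum_single_index (by simp), smul_eq_mul]
  have h1 := LinearMap.congr_fun (congrArg f hab) (Finsupp.single 0 1)
  rw [map_mul, map_one, Module.End.mul_apply, hact w, Module.End.one_apply, map_finsuppSum] at h1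
  simp only [hact, map_one, mul_one, add_zero] at h1
  rw [Finsupp.sum_comm] at h1
  obtain ⟨i, r, j, s, rfl, rfl, hij, hrs⟩ := eq_single_of_twisted_mul_eq_single v w
    (fun i r j s => r * (p i * Coord.scale (((q : ℂ) ^ l) ^ i) (s * p j)))
    (fun i r j s hr hs => mul_ne_zero hr (mul_ne_zero (hp0 i)
      (Coord.scale_ne_zero (zpow_ne_zero _ hκ) (mul_ne_zero hs (hp0 j))))) one_ne_zero h1
  have hu := IsUnit.of_mul_eq_one _ hrs
  have hu2 := isUnit_of_mul_isUnit_right (hrs ▸ isUnit_one)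
  have hi : ¬ i < 0 := fun h => hpu i h (isUnit_of_mul_isUnit_left hu2)
  have hj : ¬ j < 0 := fun h => hpu j h (isUnit_of_mul_isUnit_right
    (Coord.isUnit_of_isUnit_scale (zpow_ne_zero _ hκ) (isUnit_of_mul_isUnit_right hu2)))
  obtain rfl : i = 0 := by omega
  refine ⟨r, hu, ?_⟩
  rw [normalForm_single, show xpow Pm.x (star Pm.x) 0 = 1 from pow_zero _, mul_one]

theorem nontrivial {q : ℝ} (hq : q ≠ 0) {l : ℕ} (Pm : SMinusAlg q l) : Nontrivial Pm.A := by
  obtain ⟨f, -⟩ := exists_rep hq Pm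
  exact f.toRingHom.domain_nontrivial

theorem eq_smul_z_pow_of_isUnit {q : ℝ} (hq : q ≠ 0) {l : ℕ} (hl : 0 < l) (Pm : SMinusAlg q l)
    {a : Pm.A} (ha : IsUnit a) : ∃ c : ℂ, c ≠ 0 ∧
      ((∃ n : ℕ, a = c • Pm.z ^ n) ∨ (∃ n : ℕ, a = c • (star Pm.z) ^ n)) := by
  obtain ⟨r, hr, rfl⟩ := exists_coordHom_of_isUnit hq hl Pm ha
  obtain ⟨n, c, hc, rfl⟩ := Coord.eq_single_of_isUnit hr
  refine ⟨c, hc, ?_⟩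
  rw [coordHom_single, pow_zero, one_mul]
  obtain ⟨n, rfl | rfl⟩ := n.eq_nat_or_neg
  · exact Or.inl ⟨n, by rw [zpow_natCast, Units.val_pow_eq_pow_val]; rfl⟩
  · exact Or.inr ⟨n, by
      rw [zpow_neg, zpow_natCast, ← inv_pow, Units.val_pow_eq_pow_val]; rfl⟩

theorem pow_mem_grading {A : Type*} [Ring A] [Algebra ℂ A] {𝒜 : ℤ → Submodule ℂ A}
    (hone : (1 : A) ∈ 𝒜 0) (hmul : ∀ (m n : ℤ), ∀ a ∈ 𝒜 m, ∀ b ∈ 𝒜 n, a * b ∈ 𝒜 (m + n))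
    {d : ℤ} {a : A} (ha : a ∈ 𝒜 d) (n : ℕ) : a ^ n ∈ 𝒜 (n * d) := by
  induction n with
  | zero => simpa using hone
  | succ n ih =>
    have h := hmul _ _ _ ih _ ha
    rwa [← pow_succ, show (n : ℤ) * d + d = ((n + 1 : ℕ) : ℤ) * d by push_cast; ring] at h

end SMinus

/-- every invertible element of `O(Σ_q³(l,−))` is a nonzero scalar
multiple of `zⁿ` for some `n ∈ ℤ` (for `n < 0`, `zⁿ = (z*)^{−n}`).  In particular, for
the ℤ-grading `𝒜` determined by `deg x = 1`, `deg y = 1`, `deg z = −2`, the algebra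
contains no invertible element of degree `1`, hence the corresponding
`ℂ[u,u*]`-comodule algebra `O(Σ_q³(l,−))` is non-cleft (it is not the case that every
degree admits an invertible element of that degree). -/
theorem sminus_units_and_noncleft (q : ℝ) (hq0 : 0 < q) (hq1 : q < 1)
    (l : ℕ) (hl : 0 < l) (Pm : SMinusAlg q l) (𝒜 : ℤ → Submodule ℂ Pm.A)
    (hone : (1 : Pm.A) ∈ 𝒜 0)
    (hmul : ∀ (m n : ℤ), ∀ a ∈ 𝒜 m, ∀ b ∈ 𝒜 n, a * b ∈ 𝒜 (m + n))
    (hstar : ∀ (n : ℤ), ∀ a ∈ 𝒜 n, star a ∈ 𝒜 (-n))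
    (hdec : DirectSum.IsInternal 𝒜)
    (hx : Pm.x ∈ 𝒜 1) (hy : Pm.y ∈ 𝒜 1) (hz : Pm.z ∈ 𝒜 (-2)) :
    (∀ a : Pm.A, IsUnit a → ∃ c : ℂ, c ≠ 0 ∧
      ((∃ n : ℕ, a = c • Pm.z ^ n) ∨ (∃ n : ℕ, a = c • (star Pm.z) ^ n))) ∧
    (¬ ∃ a ∈ 𝒜 1, IsUnit a) ∧
    (¬ ∀ n : ℤ, ∃ a ∈ 𝒜 n, IsUnit a) := by
  have hq : q ≠ 0 := hq0.ne'
  have hunits := fun (a : Pm.A) (ha : IsUnit a) => SMinus.eq_smul_z_pow_of_isUnit hq hl Pm ha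
  have hdeg : ¬ ∃ a ∈ 𝒜 1, IsUnit a := by
    rintro ⟨a, ha1, ha⟩
    have := SMinus.nontrivial hq Pm
    have hmem : ∃ k : ℤ, k ≠ 1 ∧ a ∈ 𝒜 k := by
      obtain ⟨c, -, ⟨n, rfl⟩ | ⟨n, rfl⟩⟩ := hunits a ha
      · exact ⟨_, by omega, (𝒜 _).smul_mem c (SMinus.pow_mem_grading hone hmul hz n)⟩
      · exact ⟨_, by omega, (𝒜 _).smul_mem c
          (SMinus.pow_mem_grading hone hmul (hstar _ _ hz) n)⟩
    obtain ⟨k, hk, hak⟩ := hmem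
    exact ha.ne_zero (Submodule.disjoint_def.1
      (hdec.submodule_iSupIndep.pairwiseDisjoint hk) a hak ha1)
  exact ⟨hunits, hdeg, fun h => hdeg (h 1)⟩
end

section
/- Let l ≥ 1 and equip A = O(Σ_q³) with the ℤ-grading ρ_{1,l} determined by deg ζ₀ = 1, deg ζ₁ = l, deg ξ = −2l, with components A_n. Let can̄ : A ⊗ A → A ⊗ ℂ[u,u⁻¹] be the lifted canonical map a ⊗ a' ↦ Σ_n a a'_n ⊗ uⁿ, where a'_n is the degree-n component of a'. Then the cokernel of can̄ is finitely generated as a left A-module (i.e. the coaction ρ_{1,l} is almost free). -/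
open scoped TensorProduct

open Polynomial in
/-- If `s * z = 1 - c x` and `s` commutes with `x` up to the scalar `d`, then `s ^ m * z ^ m` is
the `q`-shifted factorial `∏ (1 - c d ^ i x)`. -/
theorem pow_mul_pow_eq_aeval_prod {A : Type*} [Ring A] [Algebra ℂ A] {s z x : A} {c d : ℂ}
    (hsz : s * z = 1 - c • x) (hsx : s * x = d • (x * s)) (m : ℕ) :
    s ^ m * z ^ m = aeval x (∏ i ∈ Finset.range m, (1 - C (c * d ^ i) * X)) := by
  have hpow : ∀ m : ℕ, s ^ m * x = d ^ m • (x * s ^ m) := by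
    intro m
    induction m with
    | zero => simp
    | succ m ih =>
      rw [pow_succ, mul_assoc, hsx, mul_smul_comm, ← mul_assoc, ih, smul_mul_assoc, smul_smul,
        mul_assoc, pow_succ']
  induction m with
  | zero => simp
  | succ m ih =>
    rw [Finset.prod_range_succ_comm, map_mul, ← ih, pow_succ s, pow_succ' z, mul_assoc,
      ← mul_assoc s, hsz, sub_mul, one_mul, mul_sub, smul_mul_assoc, mul_smul_comm, ← mul_assoc,
      hpow, smul_mul_assoc, smul_smul]
    simp [sub_mul, Algebra.smul_def, mul_assoc]

open Polynomial in
theorem isCoprime_one_sub_C_mul_X {a b : ℂ} (hab : a ≠ b) :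
    IsCoprime (1 - C a * X : ℂ[X]) (1 - C b * X) := by
  have h : (b - a)⁻¹ * b - (b - a)⁻¹ * a = 1 := by
    rw [← mul_sub, inv_mul_cancel₀ (sub_ne_zero.mpr hab.symm)]
  refine ⟨C ((b - a)⁻¹ * b), -C ((b - a)⁻¹ * a), ?_⟩
  have h' := congrArg (C : ℂ → ℂ[X]) h
  simp only [C_mul, C_sub, C_1] at h'
  simp only [C_mul]
  linear_combination h'

/-- The left ideals of `ζ₀ ^ m` and `(ζ₀*) ^ k` are jointly the whole algebra. -/
theorem SigmaRels.exists_mul_pow_add_mul_star_pow_eq_one {A : Type} [Ring A] [Algebra ℂ A]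
    [StarRing A] [StarModule ℂ A] {q : ℝ} {z0 z1 ξ : A} (h : SigmaRels q z0 z1 ξ)
    (hq0 : 0 < q) (hq1 : q < 1) (m k : ℕ) :
    ∃ a b : A, a * z0 ^ m + b * star z0 ^ k = 1 := by
  have hq : (q : ℂ) ≠ 0 := by exact_mod_cast hq0.ne'
  set x := z1 ^ 2 * ξ with hx
  have hzs : z0 * star z0 = 1 - (1 : ℂ) • x := by
    rw [one_smul, ← h.rel4, add_sub_cancel_right]
  have hsz : star z0 * z0 = 1 - ((q : ℂ)⁻¹ ^ 2) • x := by
    have h3 := h.rel3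
    rw [hzs, one_smul, sub_smul, one_smul] at h3
    rw [eq_sub_of_add_eq h3.symm]
    abel
  have hzx : z0 * x = ((q : ℂ) ^ 2) • (x * z0) := by
    rw [hx, pow_two z1, mul_assoc (z1 * z1), h.central_z0, ← mul_assoc, ← mul_assoc, h.rel1,
      smul_mul_assoc, mul_assoc z1, h.rel1, mul_smul_comm, smul_smul, smul_mul_assoc, pow_two]
    simp only [mul_assoc]
  have hxstar : star x = x := by
    have h4 := congrArg star h.rel4
    rw [star_add, star_mul, star_star, star_one, ← h.rel4] at h4
    exact add_left_cancel h4
  have hsx : star z0 * x = ((q : ℂ)⁻¹ ^ 2) • (x * star z0) := by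
    have h5 := congrArg star hzx
    rw [star_mul z0 x, star_smul, star_mul x z0, hxstar] at h5
    rw [h5, smul_smul]
    simp [hq]
  have hcop : IsCoprime
      (∏ i ∈ Finset.range m,
        (1 - Polynomial.C (((q : ℂ)⁻¹ ^ 2) * ((q : ℂ)⁻¹ ^ 2) ^ i) * Polynomial.X))
      (∏ i ∈ Finset.range k,
        (1 - Polynomial.C ((1 : ℂ) * ((q : ℂ) ^ 2) ^ i) * Polynomial.X)) := by
    refine IsCoprime.prod_left fun i _ => IsCoprime.prod_right fun j _ =>
      isCoprime_one_sub_C_mul_X fun hij => ?_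
    have hij' : (q⁻¹ ^ 2) * (q⁻¹ ^ 2) ^ i = 1 * (q ^ 2) ^ j := by exact_mod_cast hij
    rw [← pow_succ', ← pow_mul, one_mul, ← pow_mul] at hij'
    have h1 : 1 < q⁻¹ ^ (2 * (i + 1)) := one_lt_pow₀ ((one_lt_inv₀ hq0).mpr hq1) (by omega)
    have h2 : q ^ (2 * j) ≤ 1 := pow_le_one₀ hq0.le hq1.le
    linarith
  obtain ⟨u, v, huv⟩ := hcop
  refine ⟨Polynomial.aeval x u * star z0 ^ m, Polynomial.aeval x v * z0 ^ k, ?_⟩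
  rw [mul_assoc, mul_assoc, pow_mul_pow_eq_aeval_prod hsz hsx, pow_mul_pow_eq_aeval_prod hzs hzx,
    ← map_mul, ← map_mul, ← map_add, huv, map_one]

/-- let `l ≥ 1` and equip `A = O(Σ_q³)` with the ℤ-grading `ρ_{1,l}`
determined by `deg ζ₀ = 1`, `deg ζ₁ = l`, `deg ξ = −2l`.  The image of the lifted
canonical map `can̄ : A ⊗ A → A ⊗ ℂ[u,u⁻¹]`, `a ⊗ a' ↦ Σ_n a a'_n ⊗ uⁿ`, is the left
`A`-submodule of `A ⊗ ℂ[u,u⁻¹]` spanned by the elements `a ⊗ uⁿ` with `a` homogeneous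
of degree `n`; the cokernel of `can̄` is finitely generated as a left `A`-module, i.e.
the coaction `ρ_{1,l}` is almost free. -/
theorem sigma_coaction_one_l_almost_free (q : ℝ) (hq0 : 0 < q) (hq1 : q < 1)
    (l : ℕ) (hl : 0 < l) (P : SigmaAlg q) (𝒜 : ℤ → Submodule ℂ P.A)
    (hone : (1 : P.A) ∈ 𝒜 0)
    (hmul : ∀ (m n : ℤ), ∀ a ∈ 𝒜 m, ∀ b ∈ 𝒜 n, a * b ∈ 𝒜 (m + n))
    (hstar : ∀ (n : ℤ), ∀ a ∈ 𝒜 n, star a ∈ 𝒜 (-n))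
    (hdec : DirectSum.IsInternal 𝒜)
    (hz0 : P.z0 ∈ 𝒜 1) (hz1 : P.z1 ∈ 𝒜 (l : ℤ)) (hξ : P.ξ ∈ 𝒜 (-(2 * l) : ℤ)) :
    Module.Finite P.A
      ((P.A ⊗[ℂ] LaurentPolynomial ℂ) ⧸
        (Submodule.span P.A {t : P.A ⊗[ℂ] LaurentPolynomial ℂ |
          ∃ (n : ℤ) (a : P.A), a ∈ 𝒜 n ∧ t = a ⊗ₜ[ℂ] LaurentPolynomial.T n})) := by
  have hpow : ∀ (n : ℤ) (a : P.A), a ∈ 𝒜 n → ∀ k : ℕ, a ^ k ∈ 𝒜 (k * n) := by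
    intro n a ha k
    induction k with
    | zero => simpa using hone
    | succ k ih =>
      have h := hmul _ _ _ ih _ ha
      rw [← pow_succ] at h
      convert h using 2
      push_cast
      ring
  have hunit : ∀ j : ℤ, ∃ w v : P.A, w ∈ 𝒜 (2 * l * j) ∧ v * w = 1 := by
    have hcomm : Commute P.ξ (star P.ξ) := P.rels.unitary.trans P.rels.unitary'.symm
    intro j
    obtain ⟨k, rfl | rfl⟩ := j.eq_nat_or_neg
    · refine ⟨star P.ξ ^ k, P.ξ ^ k, ?_, by rw [← hcomm.mul_pow, P.rels.unitary, one_pow]⟩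
      convert hpow _ _ (hstar _ _ hξ) k using 2
      ring
    · refine ⟨P.ξ ^ k, star P.ξ ^ k, ?_, by rw [← hcomm.symm.mul_pow, P.rels.unitary', one_pow]⟩
      convert hpow _ _ hξ k using 2
      ring
  set M := Submodule.span P.A {t : P.A ⊗[ℂ] LaurentPolynomial ℂ |
    ∃ (n : ℤ) (a : P.A), a ∈ 𝒜 n ∧ t = a ⊗ₜ[ℂ] LaurentPolynomial.T n}
  have hmem : ∀ (n : ℤ) (a b : P.A), b ∈ 𝒜 n →
      (a * b) ⊗ₜ[ℂ] (LaurentPolynomial.T n : LaurentPolynomial ℂ) ∈ M := by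
    intro n a b hb
    rw [← smul_eq_mul, ← TensorProduct.smul_tmul']
    exact M.smul_mem a (Submodule.subset_span ⟨n, b, hb, rfl⟩)
  have hone_tmul : ∀ n : ℤ, (1 : P.A) ⊗ₜ[ℂ] (LaurentPolynomial.T n : LaurentPolynomial ℂ) ∈ M := by
    intro n
    have hl2 : (0 : ℤ) < 2 * l := by positivity
    obtain ⟨m, hm⟩ := Int.eq_ofNat_of_zero_le (Int.emod_nonneg n hl2.ne')
    obtain ⟨k, hk⟩ := Int.eq_ofNat_of_zero_le (sub_nonneg.mpr (Int.emod_lt_of_pos n hl2).le)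
    have hn := Int.emod_add_mul_ediv n (2 * l)
    obtain ⟨a, b, hab⟩ := P.rels.exists_mul_pow_add_mul_star_pow_eq_one hq0 hq1 m k
    obtain ⟨w, v, hw, hvw⟩ := hunit (n / (2 * l))
    obtain ⟨w', v', hw', hvw'⟩ := hunit (n / (2 * l) + 1)
    have h1 : w * P.z0 ^ m ∈ 𝒜 n := by
      convert hmul _ _ _ hw _ (hpow _ _ hz0 m) using 2
      linarith
    have h2 : w' * star P.z0 ^ k ∈ 𝒜 n := by
      convert hmul _ _ _ hw' _ (hpow _ _ (hstar _ _ hz0) k) using 2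
      linarith
    have h := M.add_mem (hmem n (a * v) _ h1) (hmem n (b * v') _ h2)
    rw [← TensorProduct.add_tmul, mul_assoc a, ← mul_assoc v, hvw, one_mul, mul_assoc b,
      ← mul_assoc v', hvw', one_mul, hab] at h
    exact h
  have htop : M = ⊤ := by
    refine Submodule.eq_top_iff'.mpr fun t => ?_
    induction t using TensorProduct.induction_on with
    | zero => exact M.zero_mem
    | add s t hs ht => exact M.add_mem hs ht
    | tmul a p =>
      induction p using LaurentPolynomial.induction_on' with
      | add p r hp hr => rw [TensorProduct.tmul_add]; exact M.add_mem hp hr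
      | C_mul_T n c =>
        rw [← LaurentPolynomial.smul_eq_C_mul, ← TensorProduct.smul_tmul, ← mul_one (c • a),
          ← smul_eq_mul, ← TensorProduct.smul_tmul']
        exact M.smul_mem _ (hone_tmul n)
  rw [htop]
  infer_instance
end
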